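/- Suppose 1 < n < m − 1. Then the Vietoris–Rips complex VR(F_n^m ∪ F_{n+1}^m, 2) is homotopy equivalent to a wedge sum of ( Σ_{k=2}^{n} (m+k−1−n choose k+1)·(k choose 2) + (m choose n+2)·(n+1 choose 2) ) copies of the 2-sphere S². -/

import Mathlib

open Finset

/-- An abstract simplicial complex on a vertex type `V`: a collection of nonempty
finite subsets of `V` (the faces), closed under taking nonempty subsets. -/
structure AbsSC (V : Type) where
  faces : Set (Finset V)
  not_empty_mem : ∅ ∉ faces
  down_closed : ∀ s ∈ faces, ∀ t : Finset V, t ⊆ s → t ≠ ∅ → t ∈ faces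

namespace AbsSC

variable {V W : Type}

/-- The vertex set of a simplicial complex. -/
def vertices (K : AbsSC V) : Set V := {v | ({v} : Finset V) ∈ K.faces}

/-- The geometric realization of a simplicial complex: the space of convex weightings
supported on a face, topologized as a subspace of `V → ℝ`. -/
def space (K : AbsSC V) : Type :=
  {f : V → ℝ // (∀ v, 0 ≤ f v) ∧ ∃ s ∈ K.faces, (∀ v, f v ≠ 0 → v ∈ s) ∧ ∑ v ∈ s, f v = 1}

instance (K : AbsSC V) : TopologicalSpace K.space := by unfold space; infer_instance

/-- `L` is a subcomplex of `K`. -/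
def IsSubcomplex (L K : AbsSC V) : Prop := L.faces ⊆ K.faces

/-- Homotopy equivalence of simplicial complexes (of their geometric realizations). -/
def HEquiv (K : AbsSC V) (L : AbsSC W) : Prop :=
  Nonempty (ContinuousMap.HomotopyEquiv K.space L.space)

/-- The realization of `K` is homotopy equivalent to the topological space `X`. -/
def HEquivTop (K : AbsSC V) (X : Type) [TopologicalSpace X] : Prop :=
  Nonempty (ContinuousMap.HomotopyEquiv K.space X)

/-- The inclusion of realizations induced by a subcomplex inclusion. -/
def incl {L K : AbsSC V} (h : L.faces ⊆ K.faces) : C(L.space, K.space) where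
  toFun f := ⟨f.1, f.2.1, by obtain ⟨s, hs, h1, h2⟩ := f.2.2; exact ⟨s, h hs, h1, h2⟩⟩
  continuous_toFun := Continuous.subtype_mk continuous_subtype_val _

variable [DecidableEq V]

/-- The link of a vertex. -/
def link (K : AbsSC V) (v : V) : AbsSC V where
  faces := {σ | σ ≠ ∅ ∧ v ∉ σ ∧ σ ∪ {v} ∈ K.faces}
  not_empty_mem h := h.1 rfl
  down_closed := by
    rintro s ⟨hne, hv, hs⟩ t hts htne
    exact ⟨htne, fun hvt => hv (hts hvt),
      K.down_closed _ hs _ (Finset.union_subset_union hts (Finset.Subset.refl _)) (by simp [Finset.union_eq_empty])⟩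

lemma link_subset (K : AbsSC V) (v : V) : (K.link v).faces ⊆ K.faces := by
  rintro σ ⟨hne, hv, hσ⟩
  exact K.down_closed _ hσ _ Finset.subset_union_left hne

/-- The complex induced on the vertices other than `v`. -/
def delete (K : AbsSC V) (v : V) : AbsSC V where
  faces := {σ | σ ∈ K.faces ∧ v ∉ σ}
  not_empty_mem h := K.not_empty_mem h.1
  down_closed := by
    rintro s ⟨hs, hv⟩ t hts htne
    exact ⟨K.down_closed _ hs _ hts htne, fun h => hv (hts h)⟩

/-- The star of a vertex: `st_K(v) = {σ : σ ∪ {v} ∈ K}`. -/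
def star (K : AbsSC V) (v : V) : AbsSC V where
  faces := {σ | σ ≠ ∅ ∧ σ ∪ {v} ∈ K.faces}
  not_empty_mem h := h.1 rfl
  down_closed := by
    rintro s ⟨hne, hs⟩ t hts htne
    exact ⟨htne,
      K.down_closed _ hs _ (Finset.union_subset_union hts (Finset.Subset.refl _)) (by simp [Finset.union_eq_empty])⟩

/-- The star cluster of a subcomplex `L` in `K`: the union of stars of vertices of `L`. -/
def starCluster (K L : AbsSC V) : AbsSC V where
  faces := {σ | σ ≠ ∅ ∧ ∃ v, ({v} : Finset V) ∈ L.faces ∧ σ ∪ {v} ∈ K.faces}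
  not_empty_mem h := h.1 rfl
  down_closed := by
    rintro s ⟨hne, v, hvL, hs⟩ t hts htne
    exact ⟨htne, v, hvL,
      K.down_closed _ hs _ (Finset.union_subset_union hts (Finset.Subset.refl _)) (by simp [Finset.union_eq_empty])⟩

/-- The union of two simplicial complexes. -/
def union (K₁ K₂ : AbsSC V) : AbsSC V where
  faces := K₁.faces ∪ K₂.faces
  not_empty_mem h := by
    rcases h with h | h
    exacts [K₁.not_empty_mem h, K₂.not_empty_mem h]
  down_closed := by
    rintro s (hs | hs) t hts htne
    exacts [Or.inl (K₁.down_closed _ hs _ hts htne), Or.inr (K₂.down_closed _ hs _ hts htne)]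

/-- The union of a family of simplicial complexes. -/
def iUnionC {ι : Type} (F : ι → AbsSC V) : AbsSC V where
  faces := ⋃ i, (F i).faces
  not_empty_mem h := by
    obtain ⟨i, hi⟩ := Set.mem_iUnion.mp h
    exact (F i).not_empty_mem hi
  down_closed := by
    intro s hs t hts htne
    obtain ⟨i, hi⟩ := Set.mem_iUnion.mp hs
    exact Set.mem_iUnion.mpr ⟨i, (F i).down_closed _ hi _ hts htne⟩

/-- The `n`-skeleton of a complex: all faces with at most `n+1` vertices. -/
def skeleton (K : AbsSC V) (n : ℕ) : AbsSC V where
  faces := {σ | σ ∈ K.faces ∧ σ.card ≤ n + 1}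
  not_empty_mem h := K.not_empty_mem h.1
  down_closed := by
    rintro s ⟨hs, hcard⟩ t hts htne
    exact ⟨K.down_closed _ hs _ hts htne, le_trans (Finset.card_le_card hts) hcard⟩

/-- The simplicial complex generated by a single simplex `s` (all its nonempty subsets). -/
def simplexCx (s : Finset V) : AbsSC V where
  faces := {t | t ≠ ∅ ∧ t ⊆ s}
  not_empty_mem h := h.1 rfl
  down_closed := by
    rintro a ⟨hne, has⟩ t hta htne
    exact ⟨htne, hta.trans has⟩

/-- A maximal simplex (facet) of `K`. -/
def IsFacet (K : AbsSC V) (σ : Finset V) : Prop :=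
  σ ∈ K.faces ∧ ∀ τ ∈ K.faces, σ ⊆ τ → τ = σ

/-- `K` is a clique complex: any nonempty set of vertices which pairwise span edges is a face. -/
def IsCliqueCx (K : AbsSC V) : Prop :=
  ∀ σ : Finset V, σ ≠ ∅ → (∀ v ∈ σ, ({v} : Finset V) ∈ K.faces) →
    (∀ v ∈ σ, ∀ w ∈ σ, v ≠ w → ({v, w} : Finset V) ∈ K.faces) → σ ∈ K.faces

/-- `L` is a full subcomplex of `K`. -/
def IsFull (L K : AbsSC V) : Prop :=
  ∀ σ ∈ K.faces, (∀ v ∈ σ, ({v} : Finset V) ∈ L.faces) → σ ∈ L.faces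

end AbsSC

noncomputable section

/-- The `n`-dimensional sphere. -/
abbrev Sph (n : ℕ) : Type := Metric.sphere (0 : EuclideanSpace ℝ (Fin (n + 1))) 1

/-- A base point on the sphere. -/
def sphBase (n : ℕ) : Sph n :=
  ⟨EuclideanSpace.single 0 1, by simp⟩

/-- Relation gluing the base points of `c` copies of a pointed space to an auxiliary point. -/
inductive wedgeRel (c : ℕ) (X : Type) (x₀ : X) : Unit ⊕ Fin c × X → Unit ⊕ Fin c × X → Prop
  | glue (i : Fin c) : wedgeRel c X x₀ (Sum.inl ()) (Sum.inr (i, x₀))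

/-- The wedge sum of `c` copies of the pointed space `(X, x₀)`. -/
def Wedge (c : ℕ) (X : Type) [TopologicalSpace X] (x₀ : X) : Type := Quot (wedgeRel c X x₀)

instance (c : ℕ) (X : Type) [TopologicalSpace X] (x₀ : X) : TopologicalSpace (Wedge c X x₀) := by
  unfold Wedge; infer_instance

/-- The base point of the wedge. -/
def wedgePt (c : ℕ) (X : Type) [TopologicalSpace X] (x₀ : X) : Wedge c X x₀ :=
  Quot.mk _ (Sum.inl ())

/-- The wedge sum of `c` copies of the `n`-sphere. -/
abbrev WedgeSph (n c : ℕ) : Type := Wedge c (Sph n) (sphBase n)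

/-- The base point of a wedge of spheres. -/
def wedgeSphPt (n c : ℕ) : WedgeSph n c := wedgePt c _ _

/-- Relation gluing the two base points in a binary wedge. -/
inductive wedge2Rel (X Y : Type) (x₀ : X) (y₀ : Y) : X ⊕ Y → X ⊕ Y → Prop
  | glue : wedge2Rel X Y x₀ y₀ (Sum.inl x₀) (Sum.inr y₀)

/-- The wedge sum `X ∨ Y` of two pointed spaces. -/
def Wedge2 (X Y : Type) [TopologicalSpace X] [TopologicalSpace Y] (x₀ : X) (y₀ : Y) : Type :=
  Quot (wedge2Rel X Y x₀ y₀)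

instance (X Y : Type) [TopologicalSpace X] [TopologicalSpace Y] (x₀ : X) (y₀ : Y) :
    TopologicalSpace (Wedge2 X Y x₀ y₀) := by unfold Wedge2; infer_instance

/-- Relation collapsing the top and bottom of the cylinder `X × [0,1]` to two cone points. -/
inductive suspRel (X : Type) : X × unitInterval ⊕ Bool → X × unitInterval ⊕ Bool → Prop
  | zero (x : X) : suspRel X (Sum.inl (x, 0)) (Sum.inr false)
  | one (x : X) : suspRel X (Sum.inl (x, 1)) (Sum.inr true)

/-- The (unreduced) suspension `Σ X`. -/
def Susp (X : Type) [TopologicalSpace X] : Type := Quot (suspRel X)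

instance (X : Type) [TopologicalSpace X] : TopologicalSpace (Susp X) := by
  unfold Susp; infer_instance

/-- The north cone point of the suspension. -/
def suspNorth (X : Type) [TopologicalSpace X] : Susp X := Quot.mk _ (Sum.inr true)

end

/-- The Vietoris–Rips complex at scale `r` of a collection `F` of finite subsets of `ℕ`,
with respect to the symmetric difference metric `d(A,B) = |A Δ B|`. -/
def VRc (F : Set (Finset ℕ)) (r : ℕ) : AbsSC (Finset ℕ) where
  faces := {σ | σ.Nonempty ∧ (∀ A ∈ σ, A ∈ F) ∧
    ∀ A ∈ σ, ∀ B ∈ σ, (symmDiff A B).card ≤ r}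
  not_empty_mem h := by simpa using h.1
  down_closed := by
    rintro s ⟨hne, hF, hd⟩ t hts htne
    exact ⟨Finset.nonempty_iff_ne_empty.mpr htne, fun A hA => hF A (hts hA),
      fun A hA B hB => hd A (hts hA) B (hts hB)⟩

/-- `F_n^m`: all `n`-element subsets of `[m] = {1, …, m}`. -/
def Fnm (m n : ℕ) : Set (Finset ℕ) := {A | A ⊆ Finset.Icc 1 m ∧ A.card = n}

/-- `F_{≤ n}^m`: all subsets of `[m]` of cardinality at most `n`. -/
def Fle (m n : ℕ) : Set (Finset ℕ) := {A | A ⊆ Finset.Icc 1 m ∧ A.card ≤ n}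

/-- The simplex `N[C] = {A : C ⊆ A, |A \ C| = 1}` inside `[m]`. -/
def NSimp (m : ℕ) (C : Finset ℕ) : Finset (Finset ℕ) :=
  (Finset.Icc 1 m \ C).image (fun x => insert x C)

/-- The simplex `L[S]`: all subsets of `S` obtained by removing one element. -/
def LSimp (S : Finset ℕ) : Finset (Finset ℕ) := S.image (fun x => S.erase x)

/-- The total order `≺`: first compare cardinalities, then compare the increasing
enumerations lexicographically. -/
def precLT (A B : Finset ℕ) : Prop :=
  A.card < B.card ∨
    (A.card = B.card ∧ List.Lex (· < ·) (A.sort (· ≤ ·)) (B.sort (· ≤ ·)))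

/-- `A ⪯ B`. -/
def precLE (A B : Finset ℕ) : Prop := precLT A B ∨ A = B

/-- `F^m_{≺ A}`: all subsets of `[m]` strictly preceding `A`. -/
def FprecLT (m : ℕ) (A : Finset ℕ) : Set (Finset ℕ) :=
  {B | B ⊆ Finset.Icc 1 m ∧ precLT B A}

/-- `F^m_{⪯ A}`: all subsets of `[m]` preceding (or equal to) `A`. -/
def FprecLE (m : ℕ) (A : Finset ℕ) : Set (Finset ℕ) :=
  {B | B ⊆ Finset.Icc 1 m ∧ precLE B A}

/-- The `j`-th value (0-indexed) of an enumeration `i : Fin n → ℕ`. -/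
def ith {n : ℕ} (i : Fin n → ℕ) (j : ℕ) : ℕ := if h : j < n then i ⟨j, h⟩ else 0

/-- The `ℓ`-th entry (1-indexed) of the enumeration, as an integer, with `i_0 = -1`. -/
def ivZ {n : ℕ} (i : Fin n → ℕ) (ℓ : ℕ) : ℤ := if ℓ = 0 then -1 else (ith i (ℓ - 1) : ℤ)

/-- For `B = i_1 i_2 ⋯ i_n` (increasing), with `d_1 = i_1` and
`d_ℓ = i_ℓ - (i_{ℓ-1} + 1)`, `r_B = Σ_{k=2}^{n-2} C(k,2) + Σ_{ℓ=1}^{n-2} d_ℓ·C(n-ℓ,2)`. -/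
def rA (B : Finset ℕ) : ℕ :=
  (∑ k ∈ Finset.Icc 2 (B.card - 2), Nat.choose k 2) +
    ∑ ℓ ∈ Finset.Icc 1 (B.card - 2),
      ((B.sort (· ≤ ·)).getD (ℓ - 1) 0 -
        (if ℓ = 1 then 0 else (B.sort (· ≤ ·)).getD (ℓ - 2) 0 + 1)) * Nat.choose (B.card - ℓ) 2

/-- For `B = i_1 i_2 ⋯ i_n` (increasing), with `c_1 = i_1 - 1` and
`c_ℓ = i_ℓ - (i_{ℓ-1} + 1)`, `s_B = Σ_{k=2}^{n-2} C(k,2) + Σ_{ℓ=1}^{n-2} c_ℓ·C(n-ℓ,2)`. -/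
def sA (B : Finset ℕ) : ℕ :=
  (∑ k ∈ Finset.Icc 2 (B.card - 2), Nat.choose k 2) +
    ∑ ℓ ∈ Finset.Icc 1 (B.card - 2),
      ((B.sort (· ≤ ·)).getD (ℓ - 1) 0 -
        (if ℓ = 1 then 1 else (B.sort (· ≤ ·)).getD (ℓ - 2) 0 + 1)) * Nat.choose (B.card - ℓ) 2

/-- `t_n = Σ_{A ⊆ [m], |A| = n} r_A`. -/
def tN (m n : ℕ) : ℕ :=
  ∑ A ∈ (Finset.Icc 1 m).powerset.filter (fun A => A.card = n), rA A

/-- `o_{m,n} = Σ { s_A : A ∈ F^m_{n+2}, min A ≥ 2 }`. -/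
def omn (m n : ℕ) : ℕ :=
  ∑ A ∈ (Finset.Icc 1 m).powerset.filter (fun A => A.card = n + 2 ∧ ∀ x ∈ A, 2 ≤ x), sA A

namespace AbsSC

section Realization

variable {V : Type}

/-- Every point of the realization lies in the interior of a unique face, its support. -/
lemma exists_support (K : AbsSC V) (f : K.space) :
    ∃ s ∈ K.faces, (∀ v, f.1 v ≠ 0 ↔ v ∈ s) ∧ ∑ v ∈ s, f.1 v = 1 := by
  classical
  obtain ⟨f, h0, s, hs, hsupp, hsum⟩ := f
  have hsum' : ∑ v ∈ s with f v ≠ 0, f v = 1 := by rw [← hsum, sum_filter_ne_zero]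
  refine ⟨s.filter (f · ≠ 0), K.down_closed s hs _ (filter_subset _ _) ?_, fun v => ?_, hsum'⟩
  · rintro h
    rw [h] at hsum'
    simp at hsum'
  · simp only [mem_filter]
    exact ⟨fun h => ⟨hsupp v h, h⟩, fun h => h.2⟩

/-- The faces of `K` that contain no member of `U`. -/
def avoid (K : AbsSC V) (U : Set (Finset V)) : AbsSC V where
  faces := {s | s ∈ K.faces ∧ ∀ τ ∈ U, ¬ τ ⊆ s}
  not_empty_mem h := K.not_empty_mem h.1
  down_closed s hs t hts ht :=
    ⟨K.down_closed s hs.1 t hts ht, fun τ hτ h => hs.2 τ hτ (h.trans hts)⟩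

lemma avoid_faces_subset (K : AbsSC V) (U : Set (Finset V)) : (K.avoid U).faces ⊆ K.faces :=
  fun _ h => h.1

/-- The smallest value of `f` on `τ`. -/
noncomputable def faceMin (τ : Finset V) (f : V → ℝ) : ℝ :=
  if h : τ.Nonempty then τ.inf' h f else 0

lemma faceMin_le {τ : Finset V} (f : V → ℝ) {v : V} (hv : v ∈ τ) : faceMin τ f ≤ f v := by
  rw [faceMin, dif_pos ⟨v, hv⟩]
  exact inf'_le _ hv

lemma exists_faceMin_eq {τ : Finset V} (hτ : τ.Nonempty) (f : V → ℝ) :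
    ∃ v ∈ τ, faceMin τ f = f v := by
  rw [faceMin, dif_pos hτ]
  exact exists_mem_eq_inf' hτ f

lemma faceMin_nonneg (τ : Finset V) {f : V → ℝ} (hf : ∀ v, 0 ≤ f v) : 0 ≤ faceMin τ f := by
  by_cases hτ : τ.Nonempty
  · obtain ⟨v, -, h⟩ := exists_faceMin_eq hτ f
    exact h ▸ hf v
  · simp [faceMin, hτ]

lemma faceMin_ne_zero_iff {τ : Finset V} (hτ : τ.Nonempty) {f : V → ℝ} (hf : ∀ v, 0 ≤ f v) :
    faceMin τ f ≠ 0 ↔ ∀ v ∈ τ, f v ≠ 0 := by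
  constructor
  · intro h v hv h0
    exact h (le_antisymm (h0 ▸ faceMin_le f hv) (faceMin_nonneg τ hf))
  · intro h
    obtain ⟨v, hv, hmin⟩ := exists_faceMin_eq hτ f
    exact hmin ▸ h v hv

lemma continuous_faceMin (τ : Finset V) : Continuous (faceMin τ) := by
  unfold faceMin
  split_ifs with h
  · exact Continuous.finset_inf'_apply h fun i _ => continuous_apply i
  · exact continuous_const

variable [DecidableEq V]

/-- Move the weight `c` from each vertex of `τ` to `w`. -/
def pushWeight (τ : Finset V) (w : V) (c : ℝ) (f : V → ℝ) : V → ℝ :=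
  fun v => f v - (if v ∈ τ then c else 0) + (if v = w then τ.card * c else 0)

lemma sum_pushWeight {τ s : Finset V} {w : V} (hτ : τ ⊆ s) (hw : w ∈ s) (c : ℝ) (f : V → ℝ) :
    ∑ v ∈ s, pushWeight τ w c f v = ∑ v ∈ s, f v := by
  simp only [pushWeight, sum_add_distrib, sum_sub_distrib, sum_ite_eq', hw, if_true,
    sum_ite_mem, inter_eq_right.2 hτ, sum_const, nsmul_eq_mul]
  ring

lemma pushWeight_zero (τ : Finset V) (w : V) (f : V → ℝ) : pushWeight τ w 0 f = f := by
  ext v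
  simp [pushWeight]

lemma continuous_pushWeight (τ : Finset V) (w : V) :
    Continuous fun p : ℝ × (V → ℝ) => pushWeight τ w p.1 p.2 := by
  unfold pushWeight
  refine continuous_pi fun v => ?_
  split_ifs <;> fun_prop

/-- If every face containing `τ` spans a face together with `w ∉ τ`, then moving weight from
`τ` to `w` stays inside the realization. -/
lemma pushWeight_mem (K : AbsSC V) {τ : Finset V} {w : V} (hτ : τ.Nonempty) (hw : w ∉ τ)
    (h : ∀ s ∈ K.faces, τ ⊆ s → insert w s ∈ K.faces) (f : K.space) {c : ℝ} (hc0 : 0 ≤ c)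
    (hc : c ≤ faceMin τ f.1) :
    (∀ v, 0 ≤ pushWeight τ w c f.1 v) ∧ ∃ s ∈ K.faces,
      (∀ v, pushWeight τ w c f.1 v ≠ 0 → v ∈ s) ∧ ∑ v ∈ s, pushWeight τ w c f.1 v = 1 := by
  obtain ⟨s, hs, hsupp, hsum⟩ := K.exists_support f
  have hf0 := f.2.1
  rcases hc0.eq_or_lt with rfl | hpos
  · rw [pushWeight_zero]
    exact f.2
  have hτs : τ ⊆ s := fun v hv =>
    (hsupp v).1 (ne_of_gt (lt_of_lt_of_le (hpos.trans_le hc) (faceMin_le f.1 hv)))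
  refine ⟨fun v => ?_, insert w s, h s hs hτs, fun v hv => ?_, ?_⟩
  · have h1 : (if v ∈ τ then c else 0) ≤ f.1 v := by
      split_ifs with hv
      · exact hc.trans (faceMin_le f.1 hv)
      · exact hf0 v
    have h2 : (0 : ℝ) ≤ if v = w then τ.card * c else 0 := by
      split_ifs <;> positivity
    unfold pushWeight
    linarith
  · by_contra hvs
    rw [mem_insert, not_or] at hvs
    have hv0 : f.1 v = 0 := by
      by_contra hne
      exact hvs.2 ((hsupp v).1 hne)
    apply hv
    have hvτ : v ∉ τ := fun h => hvs.2 (hτs h)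
    simp [pushWeight, hv0, hvs.1, hvτ]
  · rw [sum_pushWeight (hτs.trans (subset_insert w s)) (mem_insert_self w s)]
    refine (sum_subset (subset_insert w s) fun v _ hvs => ?_).symm.trans hsum
    by_contra hne
    exact hvs ((hsupp v).1 hne)

/-- A collapse: if the link of `τ` is a cone with apex `w`, removing the open star of `τ`
does not change the homotopy type. -/
theorem collapse (K : AbsSC V) {τ : Finset V} {w : V} (hτ : τ.Nonempty) (hw : w ∉ τ)
    (h : ∀ s ∈ K.faces, τ ⊆ s → insert w s ∈ K.faces) : K.HEquiv (K.avoid {τ}) := by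
  have hmem := K.pushWeight_mem hτ hw h
  have hcont : Continuous fun p : unitInterval × K.space =>
      pushWeight τ w (p.1 * faceMin τ p.2.1) p.2.1 := by
    refine (continuous_pushWeight τ w).comp (Continuous.prodMk ?_ ?_)
    · exact (continuous_subtype_val.comp continuous_fst).mul
        ((continuous_faceMin τ).comp (continuous_subtype_val.comp continuous_snd))
    · exact continuous_subtype_val.comp continuous_snd
  have hle (t : unitInterval) (f : K.space) : t.1 * faceMin τ f.1 ≤ faceMin τ f.1 :=
    mul_le_of_le_one_left (faceMin_nonneg τ f.2.1) t.2.2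
  have h0 (t : unitInterval) (f : K.space) : 0 ≤ t.1 * faceMin τ f.1 :=
    mul_nonneg t.2.1 (faceMin_nonneg τ f.2.1)
  let G : C(unitInterval × K.space, K.space) :=
    ⟨fun p => ⟨_, hmem p.2 (h0 p.1 p.2) (hle p.1 p.2)⟩, hcont.subtype_mk _⟩
  have hret (f : K.space) : (∀ v, 0 ≤ pushWeight τ w (faceMin τ f.1) f.1 v) ∧
      ∃ s ∈ (K.avoid {τ}).faces, (∀ v, pushWeight τ w (faceMin τ f.1) f.1 v ≠ 0 → v ∈ s) ∧
        ∑ v ∈ s, pushWeight τ w (faceMin τ f.1) f.1 v = 1 := by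
    have hm := hmem f (faceMin_nonneg τ f.2.1) le_rfl
    obtain ⟨s, hs, hsupp, hsum⟩ := K.exists_support ⟨_, hm⟩
    refine ⟨hm.1, s, ⟨hs, ?_⟩, fun v hv => (hsupp v).1 hv, hsum⟩
    rintro _ rfl hτs
    obtain ⟨v, hv, hmin⟩ := exists_faceMin_eq hτ f.1
    refine (hsupp v).2 (hτs hv) ?_
    have hvw : v ≠ w := fun e => hw (e ▸ hv)
    simp [pushWeight, hmin, hv, hvw]
  let r : C(K.space, (K.avoid {τ}).space) :=
    ⟨fun f => ⟨_, hret f⟩, by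
      refine Continuous.subtype_mk ?_ _
      have := hcont.comp (Continuous.prodMk (continuous_const (y := (1 : unitInterval)))
        continuous_id)
      simpa [Function.comp_def] using this⟩
  refine ⟨⟨r, incl (K.avoid_faces_subset {τ}), ⟨?_⟩, ⟨?_⟩⟩⟩
  · refine ContinuousMap.Homotopy.symm ⟨G, fun f => ?_, fun f => ?_⟩
    · exact Subtype.ext (by simp [G, pushWeight_zero])
    · refine Subtype.ext ?_
      change pushWeight τ w (1 * faceMin τ f.1) f.1 = pushWeight τ w (faceMin τ f.1) f.1
      rw [one_mul]
  · convert ContinuousMap.Homotopy.refl _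
    ext1 f
    refine Subtype.ext ?_
    have hf : faceMin τ f.1 = 0 := by
      by_contra hne
      obtain ⟨s, hs, hsupp, -⟩ := (K.avoid {τ}).exists_support f
      exact hs.2 τ rfl fun v hv => (hsupp v).1 ((faceMin_ne_zero_iff hτ f.2.1).1 hne v hv)
    change f.1 = pushWeight τ w (faceMin τ f.1) f.1
    rw [hf, pushWeight_zero]

/-- A sequence of collapses, in decreasing order of the rank `ρ`. -/
theorem collapse_finset (K : AbsSC V) (U : Finset (Finset V)) (ρ : Finset V → ℕ)
    (h : ∀ τ ∈ U, τ.Nonempty ∧ ∃ w ∉ τ, ∀ s ∈ K.faces, τ ⊆ s →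
      (∀ τ' ∈ U, ρ τ < ρ τ' → ¬ τ' ⊆ s) → insert w s ∈ K.faces ∧
        ∀ τ' ∈ U, ρ τ ≤ ρ τ' → τ' ⊆ insert w s → τ' ⊆ s) :
    K.HEquiv (K.avoid U) := by
  suffices H : ∀ U' ⊆ U, (∀ τ ∈ U', ∀ τ' ∈ U, ρ τ < ρ τ' → τ' ∈ U') → K.HEquiv (K.avoid U') from
    H U Subset.rfl fun _ _ τ' hτ' _ => hτ'
  intro U'
  induction U' using Finset.induction_on_min_value ρ with
  | empty =>
    intro _ _
    have : K.avoid ((∅ : Finset (Finset V)) : Set (Finset V)) = K := by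
      cases K
      simp [avoid]
    rw [this]
    exact ⟨ContinuousMap.HomotopyEquiv.refl _⟩
  | insert τ U' hτ hmin ih =>
    intro hsub hup
    rw [insert_subset_iff] at hsub
    obtain ⟨hne, w, hw, hcone⟩ := h τ hsub.1
    obtain ⟨e⟩ := ih hsub.2 fun σ hσ τ' hτ' hlt => by
      rcases mem_insert.1 (hup σ (mem_insert_of_mem hσ) τ' hτ' hlt) with rfl | h'
      · exact absurd (hmin σ hσ) hlt.not_ge
      · exact h'
    have heq : (K.avoid U').avoid {τ} = K.avoid (insert τ U' : Finset (Finset V)) := by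
      simp only [avoid, AbsSC.mk.injEq]
      ext s
      simp only [Set.mem_ofPred_eq, coe_insert, Set.mem_insert_iff, Set.mem_singleton_iff,
        forall_eq, forall_eq_or_imp, mem_coe]
      tauto
    rw [← heq]
    obtain ⟨e'⟩ := (K.avoid U').collapse hne hw fun s hs hτs => by
      obtain ⟨h1, h2⟩ := hcone s hs.1 hτs fun τ' hτ' hlt => hs.2 τ' <| by
        rcases mem_insert.1 (hup τ (mem_insert_self _ _) τ' hτ' hlt) with rfl | h'
        · exact absurd hlt (lt_irrefl _)
        · exact h'
      exact ⟨h1, fun τ' hτ' hins => hs.2 τ' hτ' (h2 τ' (hsub.2 hτ') (hmin τ' hτ') hins)⟩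
    exact ⟨e.trans e'⟩

end Realization

end AbsSC

section Quotient

open ContinuousMap Topology

variable {X Y : Type*} [TopologicalSpace X] [TopologicalSpace Y]

/-- If the collar `{μ ≤ 1/6}` of a contractible subspace `A = {μ = 0}` deforms into `A`, then the
identity deforms, through maps preserving `A`, to a map that is constant on `A`. -/
theorem exists_homotopicWith_const_on {A : Set X} [ContractibleSpace A] (μ : C(X, ℝ))
    (hμ : ∀ x, μ x = 0 ↔ x ∈ A) {r : C(X, X)} (hr : (ContinuousMap.id X).HomotopicRel r A)
    (hrA : ∀ x, μ x ≤ 1 / 6 → r x ∈ A) :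
    ∃ (f : C(X, X)) (a : X), (ContinuousMap.id X).HomotopicWith f (fun g => Set.MapsTo g A A) ∧
      ∀ x ∈ A, f x = a := by
  classical
  obtain ⟨F⟩ := hr
  have hrfix : ∀ x ∈ A, r x = x := fun x hx => (F.fst_eq_snd hx).symm
  obtain ⟨a, ⟨H⟩⟩ := id_nullhomotopic A
  let H' : unitInterval × X → X := fun q => if h : q.2 ∈ A then (H (q.1, ⟨q.2, h⟩) : X) else q.2
  have hH' : ContinuousOn H' {q | q.2 ∈ A} := by
    rw [continuousOn_iff_continuous_domRestrict]
    have : Set.domRestrict {q : unitInterval × X | q.2 ∈ A} H' =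
        fun q => (H (q.1.1, ⟨q.1.2, q.2⟩) : X) := by
      ext q
      exact dif_pos q.2
    rw [this]
    fun_prop
  let θ : unitInterval × X → unitInterval :=
    fun q => Set.projIcc 0 1 zero_le_one (q.1.1 * (1 - 6 * μ q.2))
  have hθ : Continuous θ := continuous_projIcc.comp (by fun_prop)
  let G : unitInterval × X → X := fun q => if μ q.2 ≤ 1 / 6 then H' (θ q, r q.2) else r q.2
  have hG : Continuous G := by
    refine continuous_if_le (by fun_prop) continuous_const ?_ (by fun_prop) ?_
    · exact hH'.comp (by fun_prop) fun q hq => hrA _ hq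
    · intro q hq
      have h0 : θ q = 0 := by
        simp only [θ, hq]
        norm_num
      simp [H', h0]
  have hGA : ∀ q, μ q.2 ≤ 1 / 6 → G q ∈ A := fun q hq => by
    simp only [G, H', if_pos hq, dif_pos (hrA _ hq)]
    exact (H _).2
  have hμA : ∀ x ∈ A, μ x ≤ 1 / 6 := fun x hx => by
    rw [(hμ x).2 hx]
    norm_num
  let Gc : C(unitInterval × X, X) := ⟨G, hG⟩
  let f : C(X, X) := ⟨fun x => G (1, x), by fun_prop⟩
  refine ⟨f, a, HomotopicWith.trans (g := r) ⟨⟨F.toHomotopy, fun t x hx => ?_⟩⟩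
    ⟨⟨(⟨Gc, fun x => ?_, fun x => rfl⟩ : r.Homotopy f), fun t x hx => ?_⟩⟩, fun x hx => ?_⟩
  · exact (F.eq_fst t hx).symm ▸ hx
  · have h0 : θ (0, x) = 0 := by
      simp [θ]
    simp [Gc, G, H', h0]
  · exact hGA (t, x) (hμA x hx)
  · have h1 : θ (1, x) = 1 := by
      simp [θ, (hμ x).2 hx]
    change G (1, x) = a
    simp only [G, H', if_pos (hμA x hx), h1, hrfix x hx, dif_pos hx]
    simp

/-- Collapsing `A` is a homotopy equivalence as soon as the identity deforms, through maps
preserving `A`, to a map that is constant on `A`. -/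
theorem nonempty_homotopyEquiv_of_isQuotientMap {A : Set X} {p : C(X, Y)} (hp : IsQuotientMap p)
    (hfib : ∀ x x', p x = p x' → x = x' ∨ x ∈ A ∧ x' ∈ A)
    (hpA : ∀ x ∈ A, ∀ x' ∈ A, p x = p x') {f : C(X, X)} {a : X}
    (hF : (ContinuousMap.id X).HomotopicWith f (fun g => Set.MapsTo g A A))
    (hf : ∀ x ∈ A, f x = a) : Nonempty (X ≃ₕ Y) := by
  obtain ⟨F⟩ := hF
  have hfac : Function.FactorsThrough f p := fun x x' h => by
    rcases hfib x x' h with rfl | ⟨h1, h2⟩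
    · rfl
    · rw [hf x h1, hf x' h2]
  let g : C(Y, X) := hp.lift f hfac
  have hg : ∀ x, g (p x) = f x := fun x => DFunLike.congr_fun (hp.lift_comp f hfac) x
  have hsurj := hp.surjective
  let s := Function.surjInv hsurj
  have hs : ∀ y, p (s y) = y := Function.surjInv_eq hsurj
  let G : unitInterval × Y → Y := fun q => p (F (q.1, s q.2))
  have hG : ∀ t x, G (t, p x) = p (F (t, x)) := fun t x => by
    rcases hfib _ _ (hs (p x)) with h | ⟨h1, h2⟩
    · simp [G, h]
    · exact hpA _ (F.prop t h1) _ (F.prop t h2)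
  have hGc : Continuous G := by
    refine hp.continuous_lift_prod_right ?_
    simp only [hG]
    exact p.continuous.comp F.continuous
  refine ⟨⟨p, g, ⟨ContinuousMap.Homotopy.symm (F.toHomotopy.cast rfl ?_)⟩,
    ⟨ContinuousMap.Homotopy.symm ⟨⟨G, hGc⟩, fun y => ?_, fun y => ?_⟩⟩⟩⟩
  · ext x
    exact (hg x).symm
  · obtain ⟨x, rfl⟩ := hsurj y
    simp [hG]
  · obtain ⟨x, rfl⟩ := hsurj y
    simp [hG, hg]

end Quotient

section Sphere

/-- Inverse stereographic projection in homogeneous coordinates, from the first coordinate axis. -/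
noncomputable def stereoPoint (a b u m : ℝ) : EuclideanSpace ℝ (Fin 3) :=
  !₂[(a ^ 2 + b ^ 2 + u ^ 2 - m ^ 2) / (a ^ 2 + b ^ 2 + u ^ 2 + m ^ 2),
    2 * a * m / (a ^ 2 + b ^ 2 + u ^ 2 + m ^ 2), 2 * b * m / (a ^ 2 + b ^ 2 + u ^ 2 + m ^ 2)]

lemma norm_stereoPoint {a b u m : ℝ} (h : 0 < a ^ 2 + b ^ 2 + u ^ 2 + m ^ 2) (hu : m * u = 0) :
    ‖stereoPoint a b u m‖ = 1 := by
  rw [EuclideanSpace.norm_eq, Real.sqrt_eq_one]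
  simp only [stereoPoint, Fin.sum_univ_three, Real.norm_eq_abs, sq_abs]
  simp only [Matrix.cons_val_zero, Matrix.cons_val_one, Matrix.cons_val]
  field_simp
  linear_combination (-4 * m * u) * hu

lemma Continuous.stereoPoint {X : Type*} [TopologicalSpace X] {a b u m : X → ℝ}
    (ha : Continuous a) (hb : Continuous b) (hu : Continuous u) (hm : Continuous m)
    (h : ∀ x, 0 < a x ^ 2 + b x ^ 2 + u x ^ 2 + m x ^ 2) :
    Continuous fun x => stereoPoint (a x) (b x) (u x) (m x) := by
  refine (PiLp.continuous_toLp 2 _).comp (continuous_pi fun i => ?_)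
  fin_cases i <;> exact Continuous.div (by fun_prop) (by fun_prop) fun x => (h x).ne'

lemma stereoPoint_eq_single_iff {a b u m : ℝ} (h : 0 < a ^ 2 + b ^ 2 + u ^ 2 + m ^ 2) :
    stereoPoint a b u m = EuclideanSpace.single 0 1 ↔ m = 0 := by
  constructor
  · intro e
    have e0 := congrArg (fun z : EuclideanSpace ℝ (Fin 3) => z 0) e
    simp only [stereoPoint, PiLp.toLp_apply, Matrix.cons_val_zero, PiLp.single_apply,
      if_true] at e0
    rw [div_eq_one_iff_eq h.ne'] at e0
    nlinarith
  · rintro rfl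
    ext i
    fin_cases i
    · have : a ^ 2 + b ^ 2 + u ^ 2 ≠ 0 := by nlinarith
      simp [stereoPoint, this]
    · simp [stereoPoint]
    · simp [stereoPoint]

lemma stereoPoint_eq_imp {a b m a' b' m' : ℝ} (hm : 0 < m) (hm' : 0 < m')
    (h : stereoPoint a b 0 m = stereoPoint a' b' 0 m') : a * m' = a' * m ∧ b * m' = b' * m := by
  have hD : 0 < a ^ 2 + b ^ 2 + 0 ^ 2 + m ^ 2 := by positivity
  have hD' : 0 < a' ^ 2 + b' ^ 2 + 0 ^ 2 + m' ^ 2 := by positivity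
  have e0 := congrArg (fun z : EuclideanSpace ℝ (Fin 3) => z 0) h
  have e1 := congrArg (fun z : EuclideanSpace ℝ (Fin 3) => z 1) h
  have e2 := congrArg (fun z : EuclideanSpace ℝ (Fin 3) => z 2) h
  simp only [stereoPoint, PiLp.toLp_apply, Matrix.cons_val_zero, Matrix.cons_val_one,
    Matrix.cons_val] at e0 e1 e2
  rw [div_eq_div_iff hD.ne' hD'.ne'] at e0 e1 e2
  have key : m ^ 2 * (a' ^ 2 + b' ^ 2 + 0 ^ 2 + m' ^ 2) =
      m' ^ 2 * (a ^ 2 + b ^ 2 + 0 ^ 2 + m ^ 2) := by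
    linear_combination (-1 / 2) * e0
  have hne : 2 * m * (a' ^ 2 + b' ^ 2 + 0 ^ 2 + m' ^ 2) ≠ 0 := by positivity
  constructor
  · apply mul_right_cancel₀ hne
    linear_combination m' * e1 - 2 * a' * key
  · apply mul_right_cancel₀ hne
    linear_combination m' * e2 - 2 * b' * key

lemma exists_stereoPoint_eq {z : EuclideanSpace ℝ (Fin 3)} (hz : ‖z‖ = 1)
    (hne : z ≠ EuclideanSpace.single 0 1) :
    ∃ p q : ℝ, ∀ m : ℝ, 0 < m → stereoPoint (p * m) (q * m) 0 m = z := by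
  rw [EuclideanSpace.norm_eq, Real.sqrt_eq_one] at hz
  simp only [Fin.sum_univ_three, Real.norm_eq_abs, sq_abs] at hz
  have h1 : 1 - z 0 ≠ 0 := by
    intro h
    apply hne
    have h0 : z 0 = 1 := by linarith
    rw [h0] at hz
    have h2 : z 1 = 0 := by nlinarith [sq_nonneg (z 1), sq_nonneg (z 2)]
    have h3 : z 2 = 0 := by nlinarith [sq_nonneg (z 1), sq_nonneg (z 2)]
    ext i
    fin_cases i <;> simp [h0, h2, h3]
  refine ⟨z 1 / (1 - z 0), z 2 / (1 - z 0), fun m hm => ?_⟩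
  have hD : (z 1 / (1 - z 0) * m) ^ 2 + (z 2 / (1 - z 0) * m) ^ 2 + 0 ^ 2 + m ^ 2 =
      2 * m ^ 2 / (1 - z 0) := by
    field_simp
    linear_combination m ^ 2 * hz
  ext i
  fin_cases i <;>
    simp only [stereoPoint, PiLp.toLp_apply, Fin.zero_eta, Fin.mk_one, Fin.reduceFinMk,
      Matrix.cons_val_zero, Matrix.cons_val_one, Matrix.cons_val, hD]
  · field_simp
    linear_combination m ^ 2 * hz
  · field_simp
  · field_simp

end Sphere

namespace AbsSC

variable {V : Type} [DecidableEq V]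

/-- A triangle that is not a proper face can be mapped onto the sphere, injectively on its
interior, with everything else going to the base point. -/
theorem exists_map_sphere (K : AbsSC V) {t : Finset V} (ht : t ∈ K.faces) (hcard : t.card = 3)
    (hmax : ∀ s ∈ K.faces, t ⊆ s → s = t) :
    ∃ q : C(K.space, Sph 2), (∀ x, q x = sphBase 2 ↔ faceMin t x.1 = 0) ∧
      (∀ x x', q x = q x' → faceMin t x.1 ≠ 0 → x = x') ∧
      ∀ z, z ≠ sphBase 2 → ∃ x, q x = z := by
  obtain ⟨v₀, v₁, v₂, h01, h02, h12, rfl⟩ := card_eq_three.1 hcard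
  set t : Finset V := {v₀, v₁, v₂}
  have hne : t.Nonempty := ⟨v₀, by simp [t]⟩
  have hsum (f : V → ℝ) : ∑ v ∈ t, f v = f v₀ + f v₁ + f v₂ := by
    rw [sum_insert (by simp [h01, h02]), sum_insert (by simp [h12]), sum_singleton, add_assoc]
  have hforall {P : V → Prop} : (∀ v ∈ t, P v) ↔ P v₀ ∧ P v₁ ∧ P v₂ := by simp [t]
  have hint (x : K.space) (hx : faceMin t x.1 ≠ 0) :
      (∀ v, x.1 v ≠ 0 ↔ v ∈ t) ∧ ∑ v ∈ t, x.1 v = 1 := by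
    obtain ⟨s, hs, hsupp, hs1⟩ := K.exists_support x
    obtain rfl := hmax s hs fun v hv => (hsupp v).1 ((faceMin_ne_zero_iff hne x.2.1).1 hx v hv)
    exact ⟨hsupp, hs1⟩
  let u (x : K.space) : ℝ := 1 - (x.1 v₀ + x.1 v₁ + x.1 v₂)
  have hu (x : K.space) (hx : faceMin t x.1 ≠ 0) : u x = 0 := by
    have := (hint x hx).2
    rw [hsum] at this
    simp [u, this]
  have hmu (x : K.space) : faceMin t x.1 * u x = 0 := by
    by_cases hx : faceMin t x.1 = 0
    · rw [hx, zero_mul]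
    · rw [hu x hx, mul_zero]
  have hD (x : K.space) : 0 < (x.1 v₁ - x.1 v₀) ^ 2 + (x.1 v₂ - x.1 v₀) ^ 2 + u x ^ 2 +
      faceMin t x.1 ^ 2 := by
    refine lt_of_le_of_ne (by positivity) fun h => ?_
    have h1 : x.1 v₁ - x.1 v₀ = 0 := by nlinarith
    have h2 : x.1 v₂ - x.1 v₀ = 0 := by nlinarith
    have h3 : u x = 0 := by nlinarith
    have h4 : faceMin t x.1 = 0 := by nlinarith
    obtain ⟨v, hv, hmin⟩ := exists_faceMin_eq hne x.1
    have h5 : ∀ v ∈ t, x.1 v = 1 / 3 := by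
      rw [hforall]
      refine ⟨?_, ?_, ?_⟩ <;> linarith
    rw [h5 v hv] at hmin
    linarith
  have hval (v : V) : Continuous fun x : K.space => x.1 v :=
    (continuous_apply v).comp continuous_subtype_val
  have hmin : Continuous fun x : K.space => faceMin t x.1 :=
    (continuous_faceMin t).comp continuous_subtype_val
  have huc : Continuous u :=
    continuous_const.sub (((hval v₀).add (hval v₁)).add (hval v₂))
  let q : C(K.space, Sph 2) :=
    ⟨fun x => ⟨stereoPoint (x.1 v₁ - x.1 v₀) (x.1 v₂ - x.1 v₀) (u x) (faceMin t x.1),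
        by simpa using norm_stereoPoint (hD x) (hmu x)⟩, by
      exact Continuous.subtype_mk (Continuous.stereoPoint ((hval v₁).sub (hval v₀))
        ((hval v₂).sub (hval v₀)) huc hmin hD) _⟩
  have hbase (x : K.space) : q x = sphBase 2 ↔ faceMin t x.1 = 0 :=
    Subtype.ext_iff.trans (stereoPoint_eq_single_iff (hD x))
  refine ⟨q, hbase, fun x x' h hx => ?_, fun z hz => ?_⟩
  · have hx' : faceMin t x'.1 ≠ 0 := by
      rwa [Ne, ← hbase, ← h, hbase]
    have hm := lt_of_le_of_ne (faceMin_nonneg t x.2.1) hx.symm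
    have hm' := lt_of_le_of_ne (faceMin_nonneg t x'.2.1) hx'.symm
    have h := congrArg Subtype.val h
    change stereoPoint _ _ (u x) _ = stereoPoint _ _ (u x') _ at h
    rw [hu x hx, hu x' hx'] at h
    obtain ⟨h1, h2⟩ := stereoPoint_eq_imp hm hm' h
    have hs := (hint x hx).2
    have hs' := (hint x' hx').2
    rw [hsum] at hs hs'
    have hδ : ∀ v ∈ t, x.1 v * faceMin t x'.1 - x'.1 v * faceMin t x.1 =
        x.1 v₀ * faceMin t x'.1 - x'.1 v₀ * faceMin t x.1 := by
      rw [hforall]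
      refine ⟨rfl, ?_, ?_⟩ <;> linarith
    have hδ0 : x.1 v₀ * faceMin t x'.1 - x'.1 v₀ * faceMin t x.1 = 0 := by
      obtain ⟨v, hv, hv1⟩ := exists_faceMin_eq hne x.1
      obtain ⟨w, hw, hw1⟩ := exists_faceMin_eq hne x'.1
      refine le_antisymm ?_ ?_
      · rw [← hδ v hv, ← hv1]
        nlinarith [faceMin_le x'.1 hv]
      · rw [← hδ w hw, ← hw1]
        nlinarith [faceMin_le x.1 hw]
    have hmm : faceMin t x'.1 = faceMin t x.1 := by
      have e1 := hδ v₁ (by simp [t])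
      have e2 := hδ v₂ (by simp [t])
      linear_combination hδ0 * 3 + (e1 + e2) - faceMin t x'.1 * hs + faceMin t x.1 * hs'
    have heq : ∀ v ∈ t, x.1 v = x'.1 v := fun v hv => by
      apply mul_right_cancel₀ hx
      have := hδ v hv
      rw [hδ0, hmm] at this
      linarith
    refine Subtype.ext (funext fun v => ?_)
    by_cases hv : v ∈ t
    · exact heq v hv
    · have a := not_not.1 (mt ((hint x hx).1 v).1 hv)
      have b := not_not.1 (mt ((hint x' hx').1 v).1 hv)
      rw [a, b]
  · obtain ⟨p, r, hpr⟩ := exists_stereoPoint_eq (z := z.1) (by simp)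
      fun h => hz (Subtype.ext h)
    set β : ℝ := min 0 (min p r) with hβ
    have hβ0 : β ≤ 0 := min_le_left _ _
    have hβp : β ≤ p := (min_le_right _ _).trans (min_le_left _ _)
    have hβr : β ≤ r := (min_le_right _ _).trans (min_le_right _ _)
    have hβeq : β = 0 ∨ β = p ∨ β = r := by
      rcases min_choice 0 (min p r) with h | h
      · exact Or.inl h
      · rcases min_choice p r with h' | h'
        · exact Or.inr (Or.inl (h.trans h'))
        · exact Or.inr (Or.inr (h.trans h'))
    have hden : 0 < 3 * (1 - β) + p + r := by linarith
    set m : ℝ := 1 / (3 * (1 - β) + p + r) with hm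
    have hm0 : 0 < m := by positivity
    have hm1 : m * (3 * (1 - β) + p + r) = 1 := by
      rw [hm]
      field_simp
    let f : V → ℝ := fun v => if v = v₀ then m * (1 - β) else if v = v₁ then m * (1 - β + p)
      else if v = v₂ then m * (1 - β + r) else 0
    have f0 : f v₀ = m * (1 - β) := by simp [f]
    have f1 : f v₁ = m * (1 - β + p) := by simp [f, h01.symm]
    have f2 : f v₂ = m * (1 - β + r) := by simp [f, h02.symm, h12.symm]
    have hfm : faceMin t f = m := by
      refine le_antisymm ?_ ?_
      · rcases hβeq with h | h | h
        · refine (faceMin_le f (v := v₀) (by simp [t])).trans ?_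
          rw [f0, h]
          linarith
        · refine (faceMin_le f (v := v₁) (by simp [t])).trans ?_
          rw [f1, h]
          linarith
        · refine (faceMin_le f (v := v₂) (by simp [t])).trans ?_
          rw [f2, h]
          linarith
      · have : ∀ v ∈ t, m ≤ f v := by
          rw [hforall, f0, f1, f2]
          refine ⟨?_, ?_, ?_⟩ <;> nlinarith
        obtain ⟨v, hv, h⟩ := exists_faceMin_eq hne f
        exact h ▸ this v hv
    have hf0 : ∀ v, 0 ≤ f v := fun v => by
      simp only [f]
      split_ifs
      · exact mul_nonneg hm0.le (by linarith)
      · exact mul_nonneg hm0.le (by linarith)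
      · exact mul_nonneg hm0.le (by linarith)
      · exact le_rfl
    let x : K.space := ⟨f, hf0, t, ht, fun v hv => by
      by_contra hvt
      simp only [t, mem_insert, mem_singleton, not_or] at hvt
      simp [f, hvt] at hv, by
      rw [hsum, f0, f1, f2]
      linarith⟩
    refine ⟨x, Subtype.ext ?_⟩
    have hux : u x = 0 := by
      change 1 - (f v₀ + f v₁ + f v₂) = 0
      rw [f0, f1, f2]
      linarith
    change stereoPoint (f v₁ - f v₀) (f v₂ - f v₀) (u x) (faceMin t f) = z.1
    rw [hux, hfm, ← hpr m hm0, f0, f1, f2]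
    congr 1 <;> ring

end AbsSC

section Wedge

variable {c : ℕ} {X : Type} [TopologicalSpace X] {x₀ : X}

/-- The inclusion of a wedge into the product of its pieces. -/
def Wedge.toPi : Wedge c X x₀ → Fin c → X :=
  Quot.lift (Sum.elim (fun _ _ => x₀) fun p => Function.update (fun _ => x₀) p.1 p.2) (by
    rintro _ _ ⟨i⟩
    exact (Function.update_eq_self i (fun _ => x₀)).symm)

lemma Wedge.continuous_toPi : Continuous (Wedge.toPi : Wedge c X x₀ → Fin c → X) := by
  refine continuous_quot_lift _ (Continuous.sumElim continuous_const ?_)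
  rw [continuous_prod_of_discrete_left]
  exact fun i => continuous_const.update i continuous_id

lemma Wedge.eq_wedgePt_or (w : Wedge c X x₀) :
    w = wedgePt c X x₀ ∨ ∃ i x, x ≠ x₀ ∧ w = Quot.mk _ (Sum.inr (i, x)) := by
  induction w using Quot.ind with | _ w
  rcases w with _ | ⟨i, x⟩
  · exact Or.inl rfl
  · by_cases hx : x = x₀
    · rw [hx]
      exact Or.inl (Quot.sound (.glue i)).symm
    · exact Or.inr ⟨i, x, hx, rfl⟩

lemma Wedge.toPi_wedgePt : (wedgePt c X x₀).toPi = fun _ => x₀ := rfl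

lemma Wedge.toPi_mk (i : Fin c) (x : X) :
    Wedge.toPi (Quot.mk _ (Sum.inr (i, x)) : Wedge c X x₀) = Function.update (fun _ => x₀) i x :=
  rfl

lemma Wedge.toPi_injective : Function.Injective (Wedge.toPi : Wedge c X x₀ → Fin c → X) := by
  intro w w' h
  rcases w.eq_wedgePt_or with rfl | ⟨i, x, hx, rfl⟩ <;>
    rcases w'.eq_wedgePt_or with rfl | ⟨j, y, hy, rfl⟩
  · rfl
  · have := congrFun h j
    rw [toPi_wedgePt, toPi_mk, Function.update_self] at this
    exact absurd this.symm hy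
  · have := congrFun h i
    rw [toPi_wedgePt, toPi_mk, Function.update_self] at this
    exact absurd this hx
  · have := congrFun h i
    rw [toPi_mk, toPi_mk, Function.update_self] at this
    by_cases hij : i = j
    · subst hij
      rw [Function.update_self] at this
      rw [this]
    · rw [Function.update_of_ne hij] at this
      exact absurd this hx

instance [CompactSpace X] : CompactSpace (Wedge c X x₀) := by
  unfold Wedge
  infer_instance

instance [T2Space X] : T2Space (Wedge c X x₀) :=
  T2Space.of_injective_continuous Wedge.toPi_injective Wedge.continuous_toPi

lemma Wedge.isClosedEmbedding_toPi [CompactSpace X] [T2Space X] :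
    Topology.IsClosedEmbedding (Wedge.toPi : Wedge c X x₀ → Fin c → X) :=
  Wedge.continuous_toPi.isClosedEmbedding Wedge.toPi_injective

end Wedge

namespace AbsSC

open ContinuousMap

variable {V : Type}

lemma compactSpace_space {K : AbsSC V} (hK : K.faces.Finite) : CompactSpace K.space := by
  classical
  refine isCompact_iff_compactSpace.1 ?_
  have : {f : V → ℝ | (∀ v, 0 ≤ f v) ∧ ∃ s ∈ K.faces, (∀ v, f v ≠ 0 → v ∈ s) ∧
      ∑ v ∈ s, f v = 1} = ⋃ s ∈ K.faces,
        (Set.univ.pi fun v => Set.Icc 0 (if v ∈ s then 1 else 0)) ∩ {f | ∑ v ∈ s, f v = 1} := by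
    ext f
    simp only [Set.mem_ofPred_eq, Set.mem_iUnion, Set.mem_inter_iff, Set.mem_pi, Set.mem_univ,
      true_imp_iff, Set.mem_Icc, exists_prop]
    constructor
    · rintro ⟨h0, s, hs, hsupp, hsum⟩
      refine ⟨s, hs, fun v => ⟨h0 v, ?_⟩, hsum⟩
      split_ifs with hv
      · exact hsum ▸ single_le_sum (fun v _ => h0 v) hv
      · exact (not_not.1 (mt (hsupp v) hv)).le
    · rintro ⟨s, hs, h, hsum⟩
      refine ⟨fun v => (h v).1, s, hs, fun v hv => ?_, hsum⟩
      by_contra hvs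
      exact hv (le_antisymm (by simpa [hvs] using (h v).2) (h v).1)
  change IsCompact {f : V → ℝ | _}
  rw [this]
  refine hK.isCompact_biUnion fun s _ => ?_
  exact (isCompact_univ_pi fun v => isCompact_Icc).inter_right
    (isClosed_eq (by fun_prop) continuous_const)

/-- The part of the realization where no member of `T` is in the support. -/
def avoidSet (K : AbsSC V) (T : Finset (Finset V)) : Set K.space :=
  {x | ∀ t ∈ T, faceMin t x.1 = 0}

/-- The realization of the subcomplex avoiding `T`, as a subspace. -/
def avoidHomeomorph (K : AbsSC V) (T : Finset (Finset V)) (hT : ∀ t ∈ T, t.Nonempty) :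
    (K.avoid T).space ≃ₜ K.avoidSet T where
  toFun f := ⟨incl (K.avoid_faces_subset T) f, fun t ht => by
    obtain ⟨s, hs, hsupp, -⟩ := f.2.2
    by_contra h
    exact hs.2 t ht fun v hv => hsupp v ((faceMin_ne_zero_iff (hT t ht) f.2.1).1 h v hv)⟩
  invFun x := ⟨x.1.1, x.1.2.1, by
    obtain ⟨s, hs, hsupp, hsum⟩ := K.exists_support x.1
    refine ⟨s, ⟨hs, fun t ht hts => ?_⟩, fun v => (hsupp v).1, hsum⟩
    exact (faceMin_ne_zero_iff (hT t ht) x.1.2.1).2 (fun v hv => (hsupp v).2 (hts hv))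
      (x.2 t ht)⟩
  left_inv _ := rfl
  right_inv _ := rfl
  continuous_toFun := by
    exact (map_continuous (incl (K.avoid_faces_subset T))).subtype_mk _
  continuous_invFun := by
    exact (continuous_subtype_val.comp (continuous_subtype_val (X := K.space))).subtype_mk _

lemma faceMin_eq_zero_or {K : AbsSC V} {T : Finset (Finset V)} (hne : ∀ t ∈ T, t.Nonempty)
    (hmax : ∀ t ∈ T, ∀ s ∈ K.faces, t ⊆ s → s = t) (x : K.space) :
    x ∈ K.avoidSet T ∨ ∃ t ∈ T, faceMin t x.1 ≠ 0 ∧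
      (∀ t' ∈ T, t' ≠ t → faceMin t' x.1 = 0) ∧ (∀ v, x.1 v ≠ 0 ↔ v ∈ t) ∧
        ∑ v ∈ t, x.1 v = 1 := by
  obtain ⟨s, hs, hsupp, hsum⟩ := K.exists_support x
  have key : ∀ t ∈ T, faceMin t x.1 ≠ 0 → s = t := fun t ht h => hmax t ht s hs fun v hv =>
    (hsupp v).1 ((faceMin_ne_zero_iff (hne t ht) x.2.1).1 h v hv)
  by_cases h : ∀ t ∈ T, faceMin t x.1 = 0
  · exact Or.inl h
  · push Not at h
    obtain ⟨t, ht, h⟩ := h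
    obtain rfl := key t ht h
    refine Or.inr ⟨s, ht, h, fun t' ht' hne' => ?_, hsupp, hsum⟩
    by_contra h'
    exact hne' (key t' ht' h').symm

variable [DecidableEq V]

/-- A collar of the complement of a family of disjoint open maximal triangles deforms away. -/
lemma exists_homotopicRel_avoidSet {K : AbsSC V} {T : Finset (Finset V)}
    (hcard : ∀ t ∈ T, t.card = 3) (hmax : ∀ t ∈ T, ∀ s ∈ K.faces, t ⊆ s → s = t) :
    ∃ (μ : C(K.space, ℝ)) (r : C(K.space, K.space)), (∀ x, μ x = 0 ↔ x ∈ K.avoidSet T) ∧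
      (ContinuousMap.id _).HomotopicRel r (K.avoidSet T) ∧
        ∀ x, μ x ≤ 1 / 6 → r x ∈ K.avoidSet T := by
  have hne : ∀ t ∈ T, t.Nonempty := fun t ht => card_pos.1 (by rw [hcard t ht]; norm_num)
  have hcases := faceMin_eq_zero_or hne hmax
  have hval (v : V) : Continuous fun x : K.space => x.1 v :=
    (continuous_apply v).comp continuous_subtype_val
  have hmin (t : Finset V) : Continuous fun x : K.space => faceMin t x.1 :=
    (continuous_faceMin t).comp continuous_subtype_val
  let μ : C(K.space, ℝ) :=
    ⟨fun x => ∑ t ∈ T, faceMin t x.1, continuous_finsetSum _ fun t _ => hmin t⟩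
  let cf (x : K.space) (v : V) : ℝ := ∑ t ∈ T, if v ∈ t then faceMin t x.1 else 0
  have hcf (v : V) : Continuous fun x => cf x v := by
    refine continuous_finsetSum _ fun t _ => ?_
    split_ifs
    exacts [hmin t, continuous_const]
  have hμ0 (x) : μ x = 0 ↔ x ∈ K.avoidSet T :=
    sum_eq_zero_iff_of_nonneg fun t _ => faceMin_nonneg t x.2.1
  have hcf0 (x) (hx : x ∈ K.avoidSet T) (v : V) : cf x v = 0 :=
    sum_eq_zero fun t ht => by rw [hx t ht, ite_self]
  have hμt (x : K.space) {t} (ht : t ∈ T) (h : ∀ t' ∈ T, t' ≠ t → faceMin t' x.1 = 0) :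
      μ x = faceMin t x.1 := sum_eq_single_of_mem t ht h
  have hcft (x : K.space) {t} (ht : t ∈ T) (h : ∀ t' ∈ T, t' ≠ t → faceMin t' x.1 = 0) (v : V) :
      cf x v = if v ∈ t then faceMin t x.1 else 0 :=
    sum_eq_single_of_mem t ht fun t' ht' hn => by rw [h t' ht' hn, ite_self]
  have hle (x : K.space) {t} (ht : t ∈ T) (hs : ∑ v ∈ t, x.1 v = 1) :
      3 * faceMin t x.1 ≤ 1 := by
    have := card_nsmul_le_sum t x.1 (faceMin t x.1) fun v hv => faceMin_le _ hv
    rw [hcard t ht, nsmul_eq_mul, hs] at this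
    exact_mod_cast this
  have hμ3 (x) : 0 ≤ μ x ∧ 3 * μ x ≤ 1 := by
    rcases hcases x with h | ⟨t, ht, -, h, -, hs⟩
    · rw [(hμ0 x).2 h]
      norm_num
    · rw [hμt x ht h]
      exact ⟨faceMin_nonneg t x.2.1, hle x ht hs⟩
  let κ (x : K.space) : ℝ := min 1 (2 - 6 * μ x)
  have hκ (x) : 0 ≤ κ x ∧ κ x ≤ 1 :=
    ⟨le_min zero_le_one (by linarith [hμ3 x]), min_le_left _ _⟩
  have hκc : Continuous κ := by fun_prop
  have hden (l : unitInterval) (x) : 0 < 1 - 3 * (l * κ x * μ x) := by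
    have h1 : l * κ x ≤ κ x := mul_le_of_le_one_left (hκ x).1 l.2.2
    have h2 : κ x * μ x ≤ (2 - 6 * μ x) * μ x :=
      mul_le_mul_of_nonneg_right (min_le_right _ _) (hμ3 x).1
    have h3 := mul_le_mul_of_nonneg_right h1 (hμ3 x).1
    nlinarith [sq_nonneg (6 * μ x - 1)]
  let g (p : unitInterval × K.space) (v : V) : ℝ :=
    (p.2.1 v - p.1 * κ p.2 * cf p.2 v) / (1 - 3 * (p.1 * κ p.2 * μ p.2))
  have hgA (l : unitInterval) (x) (hx : x ∈ K.avoidSet T) : g (l, x) = x.1 := by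
    ext v
    simp only [g, hcf0 x hx, (hμ0 x).2 hx, mul_zero, sub_zero, div_one]
  have hgt (l : unitInterval) (x : K.space) {t} (ht : t ∈ T)
      (h : ∀ t' ∈ T, t' ≠ t → faceMin t' x.1 = 0) (hsupp : ∀ v, x.1 v ≠ 0 ↔ v ∈ t) {v : V}
      (hv : g (l, x) v ≠ 0) : v ∈ t := by
    by_contra hvt
    apply hv
    have : x.1 v = 0 := not_not.1 (mt (hsupp v).1 hvt)
    simp [g, this, hcft x ht h, hvt]
  have hg (p) : (∀ v, 0 ≤ g p v) ∧ ∃ s ∈ K.faces, (∀ v, g p v ≠ 0 → v ∈ s) ∧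
      ∑ v ∈ s, g p v = 1 := by
    obtain ⟨l, x⟩ := p
    rcases hcases x with hx | ⟨t, ht, h0, h, hsupp, hs⟩
    · rw [hgA l x hx]
      exact x.2
    · refine ⟨fun v => div_nonneg ?_ (hden l x).le, ?_⟩
      · rw [hcft x ht h]
        split_ifs with hv
        · have h1 : l * κ x ≤ 1 := mul_le_one₀ l.2.2 (hκ x).1 (hκ x).2
          have h2 := faceMin_le x.1 hv
          have h3 := mul_le_of_le_one_left (faceMin_nonneg t x.2.1) h1
          exact sub_nonneg.2 (h3.trans h2)
        · rw [mul_zero, sub_zero]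
          exact x.2.1 v
      · obtain ⟨s, hsK, hsupp', -⟩ := K.exists_support x
        have hst : s = t := by
          ext v
          rw [← hsupp, hsupp']
        refine ⟨t, hst ▸ hsK, fun v hv => hgt l x ht h hsupp hv, ?_⟩
        simp only [g]
        rw [← sum_div, sum_sub_distrib, hs, ← mul_sum, hμt x ht h,
          sum_congr rfl fun v hv => (hcft x ht h v).trans (if_pos hv), sum_const, hcard t ht,
          div_eq_one_iff_eq (by rw [← hμt x ht h]; exact (hden l x).ne')]
        simp only [nsmul_eq_mul]
        push_cast
        ring
  have hgc : Continuous g := by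
    refine continuous_pi fun v => Continuous.div ?_ (by fun_prop) fun p => (hden p.1 p.2).ne'
    exact ((hval v).comp continuous_snd).sub
      (((continuous_subtype_val.comp continuous_fst).mul (hκc.comp continuous_snd)).mul
        ((hcf v).comp continuous_snd))
  let G : C(unitInterval × K.space, K.space) := ⟨fun p => ⟨g p, hg p⟩, hgc.subtype_mk hg⟩
  let r : C(K.space, K.space) := ⟨fun x => G (1, x), by fun_prop⟩
  refine ⟨μ, r, hμ0, ⟨⟨⟨G, fun x => ?_, fun x => rfl⟩, fun l x hx => ?_⟩⟩, fun x hx => ?_⟩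
  · refine Subtype.ext (funext fun v => ?_)
    simp [G, g]
  · exact Subtype.ext (hgA l x hx)
  · have hκ1 : κ x = 1 := min_eq_left (by linarith)
    rcases hcases x with hxA | ⟨t, ht, h0, h, hsupp, hs⟩
    · have : r x = x := Subtype.ext (hgA 1 x hxA)
      rwa [this]
    · intro t' ht'
      by_contra h'
      have h'' : ∀ v ∈ t', g (1, x) v ≠ 0 := (faceMin_ne_zero_iff (hne t' ht') (r x).2.1).1 h'
      obtain rfl : t' = t := eq_of_subset_of_card_le
        (fun v hv => hgt 1 x ht h hsupp (h'' v hv)) (by rw [hcard t ht, hcard t' ht'])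
      obtain ⟨v, hv, hmin⟩ := exists_faceMin_eq (hne t' ht) x.1
      apply h'' v hv
      simp [g, hκ1, hcft x ht h, hv, hmin]

/-- Collapsing a contractible subcomplex whose complement is a family of open maximal triangles
gives a wedge of spheres. -/
theorem hEquivTop_wedgeSph (K : AbsSC V) (hK : K.faces.Finite) (T : Finset (Finset V))
    (hTK : ∀ t ∈ T, t ∈ K.faces) (hcard : ∀ t ∈ T, t.card = 3)
    (hmax : ∀ t ∈ T, ∀ s ∈ K.faces, t ⊆ s → s = t) [ContractibleSpace (K.avoid T).space] :
    K.HEquivTop (WedgeSph 2 T.card) := by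
  have hne : ∀ t ∈ T, t.Nonempty := fun t ht => card_pos.1 (by rw [hcard t ht]; norm_num)
  have hcases := faceMin_eq_zero_or hne hmax
  obtain ⟨μ, r, hμ, hr, hrA⟩ := exists_homotopicRel_avoidSet hcard hmax
  have hA : ContractibleSpace (K.avoidSet T) :=
    (K.avoidHomeomorph T hne).symm.contractibleSpace
  obtain ⟨f, a, hF, hf⟩ := exists_homotopicWith_const_on μ hμ hr hrA
  have hKc := compactSpace_space hK
  let e := T.equivFin.symm
  choose q hq0 hqinj hqsurj using fun i => K.exists_map_sphere (hTK _ (e i).2)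
    (hcard _ (e i).2) (hmax _ (e i).2)
  have hqA (x : K.space) : (∀ i, q i x = sphBase 2) ↔ x ∈ K.avoidSet T := by
    simp only [hq0]
    refine ⟨fun h t ht => ?_, fun h i => h _ (e i).2⟩
    have := h (T.equivFin ⟨t, ht⟩)
    rwa [show e (T.equivFin ⟨t, ht⟩) = ⟨t, ht⟩ from Equiv.symm_apply_apply _ _] at this
  have hqq (x : K.space) {i} (hi : q i x ≠ sphBase 2) :
      (fun j => q j x) = Function.update (fun _ => sphBase 2) i (q i x) := by
    ext1 j
    by_cases hj : j = i
    · rw [hj, Function.update_self]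
    · rw [Function.update_of_ne hj, hq0]
      rw [Ne, hq0] at hi
      rcases hcases x with hx | ⟨t, ht, -, h, -⟩
      · exact hx _ (e j).2
      · have hit : (e i).1 = t := by
          by_contra hn
          exact hi (h _ (e i).2 hn)
        refine h _ (e j).2 fun hn => hj (e.injective (Subtype.ext (hn.trans hit.symm)))
  have hex (x : K.space) : ∃ w : WedgeSph 2 T.card, w.toPi = fun i => q i x := by
    by_cases hx : ∀ i, q i x = sphBase 2
    · exact ⟨wedgePt _ _ _, by rw [Wedge.toPi_wedgePt, funext hx]⟩
    · push Not at hx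
      obtain ⟨i, hi⟩ := hx
      exact ⟨Quot.mk _ (Sum.inr (i, q i x)), by rw [Wedge.toPi_mk, hqq x hi]⟩
  choose Φ hΦ using hex
  have hΦc : Continuous Φ := by
    rw [Wedge.isClosedEmbedding_toPi.continuous_iff, show Wedge.toPi ∘ Φ = fun x i => q i x from
      funext hΦ]
    fun_prop
  have hΦeq {x x'} (h : Φ x = Φ x') (i) : q i x = q i x' := by
    have := congrArg Wedge.toPi h
    rw [hΦ, hΦ] at this
    exact congrFun this i
  have hΦs : Function.Surjective Φ := fun w => by
    rcases w.eq_wedgePt_or with rfl | ⟨i, z, hz, rfl⟩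
    · obtain ⟨x, hx⟩ := (inferInstance : Nonempty (K.avoidSet T))
      refine ⟨x, Wedge.toPi_injective ?_⟩
      rw [hΦ, Wedge.toPi_wedgePt, funext ((hqA x).2 hx)]
    · obtain ⟨x, rfl⟩ := hqsurj i z hz
      refine ⟨x, Wedge.toPi_injective ?_⟩
      rw [hΦ, Wedge.toPi_mk, hqq x hz]
  refine nonempty_homotopyEquiv_of_isQuotientMap (p := ⟨Φ, hΦc⟩)
    (hΦc.isClosedMap.isQuotientMap hΦc hΦs) (fun x x' h => ?_) (fun x hx x' hx' => ?_) hF hf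
  · by_cases hx : ∀ i, q i x = sphBase 2
    · exact Or.inr ⟨(hqA x).1 hx, (hqA x').1 fun i => (hΦeq h i).symm.trans (hx i)⟩
    · push Not at hx
      obtain ⟨i, hi⟩ := hx
      exact Or.inl (hqinj i x x' (hΦeq h i) (mt (hq0 i x).2 hi))
  · refine Wedge.toPi_injective ?_
    change (Φ x).toPi = (Φ x').toPi
    rw [hΦ, hΦ, funext ((hqA x).2 hx), funext ((hqA x').2 hx')]

end AbsSC

section Swap

variable {α : Type*} [DecidableEq α] {A B C S R : Finset α}

lemma exists_eq_insert_erase (hcard : #A = #B) (h : #(A \ B) ≤ 1) (hne : B ≠ A) :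
    ∃ a ∈ A, ∃ b ∉ A, B = insert b (A.erase a) := by
  have h1 : #(A \ B) = 1 := le_antisymm h <| card_pos.2 <| sdiff_nonempty.2 fun hAB =>
    hne (eq_of_subset_of_card_le hAB hcard.ge).symm
  have h2 : #(B \ A) = 1 := (card_sdiff_comm hcard).symm.trans h1
  obtain ⟨a, ha⟩ := card_eq_one.1 h1
  obtain ⟨b, hb⟩ := card_eq_one.1 h2
  have ha' : ∀ c, (c ∈ A ∧ c ∉ B) ↔ c = a := fun c => by
    rw [← mem_sdiff, ha, mem_singleton]
  have hb' : ∀ c, (c ∈ B ∧ c ∉ A) ↔ c = b := fun c => by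
    rw [← mem_sdiff, hb, mem_singleton]
  refine ⟨a, ((ha' a).2 rfl).1, b, ((hb' b).2 rfl).2, ?_⟩
  ext c
  have := ha' c
  have := hb' c
  simp only [mem_insert, mem_erase]
  tauto

lemma card_sdiff_le_of_subset (hA : A ⊆ S) (hB : B ⊆ S) (h : #S ≤ #B + 1) : #(A \ B) ≤ 1 := by
  have := card_le_card (sdiff_subset_sdiff hA (Subset.refl B))
  rw [card_sdiff_of_subset hB] at this
  lia

lemma card_sdiff_le_of_superset (hA : C ⊆ A) (hB : C ⊆ B) (h : #A ≤ #C + 1) :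
    #(A \ B) ≤ 1 := by
  have := card_le_card (sdiff_subset_sdiff (Subset.refl A) hB)
  rw [card_sdiff_of_subset hA] at this
  lia

lemma subset_of_erase_subset {x y : α} (hxy : x ≠ y) (hx : S.erase x ⊆ R) (hy : S.erase y ⊆ R) :
    S ⊆ R := fun c hc => by
  by_cases h : c = x
  · exact hy (mem_erase.2 ⟨h ▸ hxy, hc⟩)
  · exact hx (mem_erase.2 ⟨h, hc⟩)

lemma card_add_three_le {x y z : α} (hx : x ∈ S) (hy : y ∈ S) (hz : z ∈ S) (hxy : x ≠ y)
    (hxz : x ≠ z) (hyz : y ≠ z) (hCx : x ∉ C) (hCy : y ∉ C) (hCz : z ∉ C) (hC : C ⊆ S) :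
    #C + 3 ≤ #S := by
  have h1 : C ⊆ ((S.erase x).erase y).erase z := fun c hc => by
    simp only [mem_erase]
    exact ⟨fun h => hCz (h ▸ hc), fun h => hCy (h ▸ hc), fun h => hCx (h ▸ hc), hC hc⟩
  have h2 := card_le_card h1
  have h3 := card_erase_add_one hx
  have h4 := card_erase_add_one (mem_erase.2 ⟨hxy.symm, hy⟩)
  have h5 := card_erase_add_one (mem_erase.2 ⟨hyz.symm, mem_erase.2 ⟨hxz.symm, hz⟩⟩)
  lia

/-- A set that is at distance at most one exchange from three sets `S \ {p}` lies in `S`. -/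
lemma subset_of_card_erase_sdiff {x y z : α} (hB : #B + 1 = #S) (hx : x ∈ S) (hy : y ∈ S)
    (hz : z ∈ S) (hxy : x ≠ y) (hxz : x ≠ z) (hyz : y ≠ z) (hBx : #(B \ S.erase x) ≤ 1)
    (hBy : #(B \ S.erase y) ≤ 1) (hBz : #(B \ S.erase z) ≤ 1) : B ⊆ S := by
  by_contra hBS
  obtain ⟨b, hb, hbS⟩ := not_subset.1 hBS
  have key : ∀ p ∈ S, #(B \ S.erase p) ≤ 1 → p ∉ B ∧ B.erase b ⊆ S := by
    intro p hp h
    rw [card_le_one] at h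
    have hbp : b ∈ B \ S.erase p := mem_sdiff.2 ⟨hb, fun h => hbS (mem_of_mem_erase h)⟩
    refine ⟨fun hpB => hbS ?_, fun c hc => ?_⟩
    · rw [h b hbp p (mem_sdiff.2 ⟨hpB, notMem_erase p S⟩)]
      exact hp
    · by_contra hcS
      exact (mem_erase.1 hc).1
        (h c (mem_sdiff.2 ⟨mem_of_mem_erase hc, fun h => hcS (mem_of_mem_erase h)⟩) b hbp)
  have h1 := card_add_three_le hx hy hz hxy hxz hyz
    (fun h => (key x hx hBx).1 (mem_of_mem_erase h))
    (fun h => (key y hy hBy).1 (mem_of_mem_erase h))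
    (fun h => (key z hz hBz).1 (mem_of_mem_erase h)) (key x hx hBx).2
  have := card_erase_add_one hb
  lia

lemma exists_eq_erase_of_subset (hB : B ⊆ S) (h : #B + 1 = #S) : ∃ p ∈ S, B = S.erase p := by
  have : #(S \ B) = 1 := by
    rw [card_sdiff_of_subset hB]
    lia
  obtain ⟨p, hp⟩ := card_eq_one.1 this
  have hpS : p ∈ S \ B := hp ▸ mem_singleton_self p
  refine ⟨p, (mem_sdiff.1 hpS).1, ?_⟩
  rw [erase_eq, ← hp, Finset.sdiff_sdiff_eq_self hB]

lemma sum_insert_erase {A : Finset ℕ} {a b : ℕ} (ha : a ∈ A) (hb : b ∉ A) :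
    ∑ i ∈ insert b (A.erase a), i + a = ∑ i ∈ A, i + b := by
  rw [sum_insert fun h => hb (mem_of_mem_erase h)]
  have := sum_erase_add A (fun i => i) ha
  lia

lemma sup_id_mem {S : Finset ℕ} (hS : S.Nonempty) : S.sup id ∈ S := by
  obtain ⟨x, hx, h⟩ := exists_mem_eq_sup S hS id
  exact h ▸ hx

lemma le_sup_id {S : Finset ℕ} {x : ℕ} (hx : x ∈ S) : x ≤ S.sup id := le_sup (f := id) hx

end Swap

namespace Johnson

variable {M N : ℕ}

/-- The complex of sets of pairwise adjacent vertices of the Johnson graph of `N`-element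
subsets of `{0, …, M - 1}`. -/
def cx (M N : ℕ) : AbsSC (Finset ℕ) where
  faces := {s | s.Nonempty ∧ (∀ A ∈ s, A ⊆ range M ∧ #A = N) ∧ ∀ A ∈ s, ∀ B ∈ s, #(A \ B) ≤ 1}
  not_empty_mem h := by simpa using h.1
  down_closed _ hs _ hts ht := ⟨nonempty_iff_ne_empty.2 ht, fun A hA => hs.2.1 A (hts hA),
    fun A hA B hB => hs.2.2 A (hts hA) B (hts hB)⟩

/-- The triangles `{S \ {x}, S \ {y}, S \ {z}}` with `x, y, z` distinct from `max S`. -/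
def lowTriangles (M N : ℕ) : Set (Finset (Finset ℕ)) :=
  {τ | ∃ S ⊆ range M, #S = N + 1 ∧ ∃ x ∈ S, ∃ y ∈ S, ∃ z ∈ S, x ≠ y ∧ x ≠ z ∧ y ≠ z ∧
    x < S.sup id ∧ y < S.sup id ∧ z < S.sup id ∧ τ = {S.erase x, S.erase y, S.erase z}}

/-- The triangles `{S \ {y}, S \ {x}, S \ {max S}}` with `z < y < x < max S` for some `z ∉ S`. -/
def critTriangles (M N : ℕ) : Set (Finset (Finset ℕ)) :=
  {τ | ∃ S ⊆ range M, #S = N + 1 ∧ ∃ z ∉ S, ∃ y ∈ S, ∃ x ∈ S, z < y ∧ y < x ∧ x < S.sup id ∧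
    τ = {S.erase y, S.erase x, S.erase (S.sup id)}}

/-- The vertices `A` for which some element can be lowered, and the edges lowering an element of
`A` to one that is not the least possible. -/
def lowering (M : ℕ) : Set (Finset (Finset ℕ)) :=
  {τ | ∃ A ⊆ range M, ∃ x ∈ A, ∃ y ∉ A, y < x ∧
    (τ = {A} ∨ (∃ z ∉ A, z < y) ∧ τ = {A, insert y (A.erase x)})}

lemma triple_subset {A B C : Finset ℕ} {s : Finset (Finset ℕ)} :
    {A, B, C} ⊆ s ↔ A ∈ s ∧ B ∈ s ∧ C ∈ s := by
  simp [insert_subset_iff]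

lemma finite_of_subset_range {U : Set (Finset (Finset ℕ))} (h : ∀ τ ∈ U, ∀ A ∈ τ, A ⊆ range M) :
    U.Finite :=
  ((range M).powerset.powerset.finite_toSet).subset fun τ hτ =>
    mem_coe.2 (mem_powerset.2 fun A hA => mem_powerset.2 (h τ hτ A hA))

lemma finite_lowTriangles : (lowTriangles M N).Finite := by
  refine finite_of_subset_range (M := M) ?_
  rintro _ ⟨S, hS, -, x, -, y, -, z, -, -, -, -, -, -, -, rfl⟩ A hA
  simp only [mem_insert, mem_singleton] at hA
  rcases hA with rfl | rfl | rfl <;> exact (erase_subset _ _).trans hS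

lemma finite_critTriangles : (critTriangles M N).Finite := by
  refine finite_of_subset_range (M := M) ?_
  rintro _ ⟨S, hS, -, z, -, y, -, x, -, -, -, -, rfl⟩ A hA
  simp only [mem_insert, mem_singleton] at hA
  rcases hA with rfl | rfl | rfl <;> exact (erase_subset _ _).trans hS

lemma finite_lowering : (lowering M).Finite := by
  refine finite_of_subset_range (M := M) ?_
  rintro _ ⟨A, hA, x, hx, y, -, hyx, rfl | ⟨-, rfl⟩⟩ B hB
  · rwa [mem_singleton.1 hB]
  · have hy : y ∈ range M := mem_range.2 (hyx.trans (mem_range.1 (hA hx)))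
    simp only [mem_insert, mem_singleton] at hB
    rcases hB with rfl | rfl
    exacts [hA, insert_subset hy ((erase_subset _ _).trans hA)]

lemma finite_faces : (cx M N).faces.Finite :=
  finite_of_subset_range (M := M) fun _ hs A hA => (hs.2.1 A hA).1

lemma subset_of_triple {s : Finset (Finset ℕ)} (hs : s ∈ (cx M N).faces) {S : Finset ℕ}
    (hS : #S = N + 1) {x y z : ℕ} (hx : x ∈ S) (hy : y ∈ S) (hz : z ∈ S) (hxy : x ≠ y)
    (hxz : x ≠ z) (hyz : y ≠ z) (h : {S.erase x, S.erase y, S.erase z} ⊆ s) :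
    ∀ B ∈ s, B ⊆ S := fun B hB => by
  rw [triple_subset] at h
  exact subset_of_card_erase_sdiff (by rw [(hs.2.1 B hB).2, hS]) hx hy hz hxy hxz hyz
    (hs.2.2 _ hB _ h.1) (hs.2.2 _ hB _ h.2.1) (hs.2.2 _ hB _ h.2.2)

lemma mem_faces_of_subset {s : Finset (Finset ℕ)} {S : Finset ℕ} (hs : s.Nonempty)
    (hS : #S = N + 1) (h : ∀ A ∈ s, A ⊆ range M ∧ #A = N) (hsub : ∀ A ∈ s, A ⊆ S) :
    s ∈ (cx M N).faces :=
  ⟨hs, h, fun A hA B hB =>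
    card_sdiff_le_of_subset (hsub A hA) (hsub B hB) (by rw [hS, (h B hB).2])⟩

lemma mem_faces_of_superset {s : Finset (Finset ℕ)} {C : Finset ℕ} (hs : s.Nonempty)
    (hC : #C + 1 = N) (h : ∀ A ∈ s, A ⊆ range M ∧ #A = N) (hsub : ∀ A ∈ s, C ⊆ A) :
    s ∈ (cx M N).faces :=
  ⟨hs, h, fun A hA B hB =>
    card_sdiff_le_of_superset (hsub A hA) (hsub B hB) (by rw [hC, (h A hA).2])⟩

/-- A low triangle consisting of subsets of `S` does not involve `S \ {max S}`. -/
lemma subset_of_lowTriangle_subset_insert {τ s : Finset (Finset ℕ)} (hτ : τ ∈ lowTriangles M N)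
    {S : Finset ℕ} (hS : #S = N + 1) (hsub : ∀ A ∈ s, A ⊆ S)
    (h : τ ⊆ insert (S.erase (S.sup id)) s) : τ ⊆ s := by
  obtain ⟨S', -, hS', x, hx, y, hy, z, hz, hxy, -, -, hxm, hym, hzm, rfl⟩ := hτ
  have hsub' : ∀ A ∈ insert (S.erase (S.sup id)) s, A ⊆ S := by
    rw [forall_mem_insert]
    exact ⟨erase_subset _ _, hsub⟩
  rw [triple_subset] at h
  obtain rfl : S' = S := eq_of_subset_of_card_le
    (subset_of_erase_subset hxy (hsub' _ h.1) (hsub' _ h.2.1)) (by rw [hS, hS'])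
  rw [triple_subset]
  have key : ∀ p ∈ S', p < S'.sup id → S'.erase p ∈ insert (S'.erase (S'.sup id)) s →
      S'.erase p ∈ s := fun p hp hpm h =>
    (mem_insert.1 h).resolve_left fun h => hpm.ne ((erase_inj S' hp).1 h)
  exact ⟨key x hx hxm h.1, key y hy hym h.2.1, key z hz hzm h.2.2⟩

/-- Removing all low triangles does not change the homotopy type. -/
theorem hEquiv_avoid_lowTriangles : (cx M N).HEquiv ((cx M N).avoid (lowTriangles M N)) := by
  rw [← finite_lowTriangles.coe_toFinset]
  refine AbsSC.collapse_finset _ _ (fun _ => 0) fun τ hτ => ?_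
  rw [Set.Finite.mem_toFinset] at hτ
  obtain ⟨S, hSM, hS, x, hx, y, hy, z, hz, hxy, hxz, hyz, hxm, hym, hzm, rfl⟩ := hτ
  have hm := sup_id_mem ⟨x, hx⟩
  refine ⟨insert_nonempty _ _, S.erase (S.sup id), ?_, fun s hs hτs _ => ?_⟩
  · simp only [mem_insert, mem_singleton, erase_inj S hm]
    lia
  · have hsub := subset_of_triple hs hS hx hy hz hxy hxz hyz hτs
    refine ⟨mem_faces_of_subset (insert_nonempty _ _) hS ?_ ?_, fun τ' hτ' _ h => ?_⟩
    · rw [forall_mem_insert]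
      refine ⟨⟨(erase_subset _ _).trans hSM, ?_⟩, hs.2.1⟩
      rw [card_erase_of_mem hm, hS, Nat.add_sub_cancel]
    · rw [forall_mem_insert]
      exact ⟨erase_subset _ _, hsub⟩
    · exact subset_of_lowTriangle_subset_insert ((Set.Finite.mem_toFinset _).1 hτ') hS hsub h

lemma card_of_mem_critTriangles {τ : Finset (Finset ℕ)} (hτ : τ ∈ critTriangles M N) :
    #τ = 3 := by
  obtain ⟨S, -, -, z, -, y, hy, x, hx, -, hyx, hxm, rfl⟩ := hτ
  refine card_eq_three.2 ⟨_, _, _, ?_, ?_, ?_, rfl⟩ <;>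
    simp only [Ne, erase_inj S hx, erase_inj S hy] <;> lia

lemma critTriangles_subset_faces {τ : Finset (Finset ℕ)} (hτ : τ ∈ critTriangles M N) :
    τ ∈ ((cx M N).avoid (lowTriangles M N)).faces := by
  have hτ3 := card_of_mem_critTriangles hτ
  obtain ⟨S, hSM, hS, z, -, y, hy, x, hx, -, hyx, hxm, rfl⟩ := hτ
  have hm := sup_id_mem ⟨x, hx⟩
  have hsub : ∀ A ∈ ({S.erase y, S.erase x, S.erase (S.sup id)} : Finset (Finset ℕ)), A ⊆ S := by
    simp [erase_subset]
  refine ⟨mem_faces_of_subset (insert_nonempty _ _) hS (fun A hA => ?_) hsub,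
    fun τ' hτ' h => ?_⟩
  · refine ⟨(hsub A hA).trans hSM, ?_⟩
    simp only [mem_insert, mem_singleton] at hA
    rcases hA with rfl | rfl | rfl
    all_goals rw [card_erase_of_mem (by assumption), hS, Nat.add_sub_cancel]
  · have hsub' := subset_of_lowTriangle_subset_insert hτ' hS (s := {S.erase y, S.erase x})
      (by simp [erase_subset]) (h.trans (by
        intro
        simp only [mem_insert, mem_singleton]
        tauto))
    have h1 := card_le_card hsub'
    obtain ⟨S', -, -, x', hx', y', hy', z', hz', hxy, hxz, hyz, -, -, -, rfl⟩ := hτ'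
    have h2 := card_le_two (a := S.erase y) (b := S.erase x)
    rw [card_eq_three.2 ⟨_, _, _, by rwa [Ne, erase_inj S' hx'], by rwa [Ne, erase_inj S' hx'],
      by rwa [Ne, erase_inj S' hy'], rfl⟩] at h1
    lia

lemma eq_of_critTriangle_subset {τ s : Finset (Finset ℕ)} (hτ : τ ∈ critTriangles M N)
    (hs : s ∈ ((cx M N).avoid (lowTriangles M N)).faces) (h : τ ⊆ s) : s = τ := by
  obtain ⟨S, hSM, hS, z, -, y, hy, x, hx, -, hyx, hxm, rfl⟩ := hτ
  have hm := sup_id_mem ⟨x, hx⟩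
  refine Subset.antisymm (fun B hB => ?_) h
  have hBS := subset_of_triple hs.1 hS hy hx hm hyx.ne (hyx.trans hxm).ne hxm.ne h B hB
  obtain ⟨p, hp, rfl⟩ := exists_eq_erase_of_subset hBS (by rw [(hs.1.2.1 B hB).2, hS])
  by_contra hpτ
  simp only [mem_insert, mem_singleton, erase_inj S hp, not_or] at hpτ
  rw [triple_subset] at h
  exact hs.2 _ ⟨S, hSM, hS, y, hy, x, hx, p, hp, hyx.ne, Ne.symm hpτ.1, Ne.symm hpτ.2.1,
    hyx.trans hxm, hxm, lt_of_le_of_ne (le_sup_id hp) hpτ.2.2, rfl⟩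
    (triple_subset.2 ⟨h.1, h.2.1, hB⟩)

end Johnson

namespace Johnson

variable {M N : ℕ}

/-- The order in which `lowering` is processed. -/
def rank (τ : Finset (Finset ℕ)) : ℕ := 2 * τ.sup (fun A => ∑ i ∈ A, i) + #τ

lemma rank_singleton (A : Finset ℕ) : rank {A} = 2 * ∑ i ∈ A, i + 1 := by
  rw [rank, sup_singleton, card_singleton]

lemma rank_pair {A : Finset ℕ} {x y : ℕ} (hx : x ∈ A) (hy : y ∉ A) (hyx : y < x) :
    rank {A, insert y (A.erase x)} = 2 * ∑ i ∈ A, i + 2 := by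
  have hsum := sum_insert_erase hx hy
  rw [rank, sup_insert, sup_singleton, card_pair, max_eq_left (by lia)]
  intro h
  rw [← h] at hsum
  lia

lemma exists_least_notMem (A : Finset ℕ) : ∃ y ∉ A, ∀ z ∉ A, y ≤ z :=
  ⟨Nat.find A.exists_notMem, Nat.find_spec A.exists_notMem, fun _ hz => Nat.find_min' _ hz⟩

/-- If `A` is top-ranked in a face, all other members are obtained from `A` by lowering. -/
lemma eq_or_lower {s : Finset (Finset ℕ)} (hs : s ∈ (cx M N).faces) {A : Finset ℕ} (hA : A ∈ s)
    (hmax : ∀ τ ∈ lowering M, 2 * ∑ i ∈ A, i + 2 < rank τ → ¬ τ ⊆ s) :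
    ∀ B ∈ s, B = A ∨ ∃ a ∈ A, ∃ b ∉ A, b < a ∧ B = insert b (A.erase a) := by
  intro B hB
  by_cases hBA : B = A
  · exact Or.inl hBA
  obtain ⟨a, ha, b, hb, rfl⟩ := exists_eq_insert_erase
    (by rw [(hs.2.1 A hA).2, (hs.2.1 B hB).2]) (hs.2.2 A hA B hB) hBA
  refine Or.inr ⟨a, ha, b, hb, ?_, rfl⟩
  by_contra hba
  have hab : a < b := lt_of_le_of_ne (not_lt.1 hba) fun h => hb (h ▸ ha)
  refine hmax {insert b (A.erase a)} ⟨_, (hs.2.1 _ hB).1, b, mem_insert_self _ _, a, ?_, hab,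
    Or.inl rfl⟩ ?_ (singleton_subset_iff.2 hB)
  · simp [hab.ne]
  · have := sum_insert_erase ha hb
    rw [rank_singleton]
    lia

/-- Lowering to the least missing element creates no new low or critical triangle when all members
share all but one element. -/
lemma mem_avoid_of_superset {s : Finset (Finset ℕ)} {C : Finset ℕ} (hs : s.Nonempty)
    (hC : #C + 1 = N) (h : ∀ A ∈ s, A ⊆ range M ∧ #A = N) (hsub : ∀ A ∈ s, C ⊆ A) :
    s ∈ (((cx M N).avoid (lowTriangles M N)).avoid (critTriangles M N)).faces := by
  have key : ∀ S : Finset ℕ, #S = N + 1 → ∀ x ∈ S, ∀ y ∈ S, ∀ z ∈ S, x ≠ y → x ≠ z → y ≠ z →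
      ¬ {S.erase x, S.erase y, S.erase z} ⊆ s := by
    intro S hS x hx y hy z hz hxy hxz hyz hsubs
    rw [triple_subset] at hsubs
    have hx' := hsub _ hsubs.1
    have hy' := hsub _ hsubs.2.1
    have hz' := hsub _ hsubs.2.2
    have := card_add_three_le hx hy hz hxy hxz hyz (fun h => notMem_erase _ _ (hx' h))
      (fun h => notMem_erase _ _ (hy' h)) (fun h => notMem_erase _ _ (hz' h))
      (hx'.trans (erase_subset _ _))
    lia
  refine ⟨⟨mem_faces_of_superset hs hC h hsub, ?_⟩, ?_⟩
  · rintro _ ⟨S, -, hS, x, hx, y, hy, z, hz, hxy, hxz, hyz, -, -, -, rfl⟩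
    exact key S hS x hx y hy z hz hxy hxz hyz
  · rintro _ ⟨S, -, hS, z, -, y, hy, x, hx, -, hyx, hxm, rfl⟩
    exact key S hS y hy x hx _ (sup_id_mem ⟨x, hx⟩) hyx.ne (hyx.trans hxm).ne hxm.ne

/-- A lowering pattern of rank at least that of `A` does not involve the lowering of an element
of `A` to the least missing one. -/
lemma subset_of_lowering_subset_insert {s τ : Finset (Finset ℕ)} {A : Finset ℕ}
    (hdich : ∀ B ∈ s, B = A ∨ ∃ a ∈ A, ∃ b ∉ A, b < a ∧ B = insert b (A.erase a)) {x y : ℕ}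
    (hx : x ∈ A) (hy : y ∉ A) (hyx : y < x) (hmin : ∀ z ∉ A, y ≤ z) (hτ : τ ∈ lowering M)
    (hrank : 2 * ∑ i ∈ A, i + 1 ≤ rank τ) (h : τ ⊆ insert (insert y (A.erase x)) s) : τ ⊆ s := by
  rw [← subset_insert_iff_of_notMem]
  · exact h
  intro hw
  have hsumw := sum_insert_erase hx hy
  have hlt : ∀ B ∈ insert (insert y (A.erase x)) s, B ≠ A → ∑ i ∈ B, i < ∑ i ∈ A, i := by
    rw [forall_mem_insert]
    refine ⟨fun _ => by lia, fun B hB hBA => ?_⟩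
    obtain ⟨a, ha, b, hb, hba, rfl⟩ := (hdich B hB).resolve_left hBA
    have := sum_insert_erase ha hb
    lia
  obtain ⟨A', -, x', hx', y', hy', hyx', rfl | ⟨⟨z, hz, hzy⟩, rfl⟩⟩ := hτ
  · rw [mem_singleton] at hw
    rw [← hw, rank_singleton] at hrank
    lia
  · rw [rank_pair hx' hy' hyx'] at hrank
    obtain rfl : A' = A := by
      by_contra hne
      have := hlt A' (h (mem_insert_self _ _)) hne
      lia
    rw [mem_insert, mem_singleton] at hw
    rcases hw with hw | hw
    · rw [hw] at hsumw
      lia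
    · have : y' ∈ insert y (A'.erase x) := hw ▸ mem_insert_self _ _
      rw [mem_insert] at this
      rcases this with rfl | h
      · exact absurd (hmin z hz) (by lia)
      · exact hy' (mem_of_mem_erase h)

/-- The vertex case: the link of `A`, among lower faces, is a cone. -/
lemma insert_mem_of_vertex {s : Finset (Finset ℕ)} {A : Finset ℕ}
    (hs : s ∈ (((cx M N).avoid (lowTriangles M N)).avoid (critTriangles M N)).faces)
    (hA : A ∈ s) {x y : ℕ} (hx : x ∈ A) (hy : y ∉ A) (hyx : y < x) (hmin : ∀ z ∉ A, y ≤ z)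
    (hmax : ∀ τ ∈ lowering M, 2 * ∑ i ∈ A, i + 1 < rank τ → ¬ τ ⊆ s) :
    insert (insert y (A.erase (A.sup id))) s ∈
      (((cx M N).avoid (lowTriangles M N)).avoid (critTriangles M N)).faces := by
  have hJ := hs.1.1
  have hAM := (hJ.2.1 A hA).1
  have hyM : y ∈ range M := mem_range.2 (hyx.trans (mem_range.1 (hAM hx)))
  have hsubS : ∀ B ∈ s, B ⊆ insert y A := by
    intro B hB
    obtain rfl | ⟨a, ha, b, hb, hba, rfl⟩ :=
      eq_or_lower hJ hA (fun τ hτ h => hmax τ hτ (by lia)) B hB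
    · exact subset_insert _ _
    · obtain rfl : b = y := by
        by_contra hne
        refine hmax {A, insert b (A.erase a)} ⟨A, hAM, a, ha, b, hb, hba,
          Or.inr ⟨⟨y, hy, lt_of_le_of_ne (hmin b hb) (Ne.symm hne)⟩, rfl⟩⟩ ?_ ?_
        · rw [rank_pair ha hb hba]
          lia
        · rw [insert_subset_iff, singleton_subset_iff]
          exact ⟨hA, hB⟩
      exact insert_subset_insert _ (erase_subset _ _)
  have hyx' : y < A.sup id := hyx.trans_le (le_sup_id hx)
  have hsup : (insert y A).sup id = A.sup id := by
    rw [sup_insert, sup_eq_right]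
    exact hyx'.le
  have hw : insert y (A.erase (A.sup id)) = (insert y A).erase ((insert y A).sup id) := by
    rw [hsup, erase_insert_of_ne hyx'.ne]
  have hAS : A = (insert y A).erase y := (erase_insert hy).symm
  have hS : #(insert y A) = N + 1 := by
    rw [card_insert_of_notMem hy, (hJ.2.1 A hA).2]
  have hSM : insert y A ⊆ range M := insert_subset hyM hAM
  have hyS : y ∈ insert y A := mem_insert_self _ _
  have hzS : ∀ z ∉ insert y A, y < z := fun z hz => by
    rw [mem_insert, not_or] at hz
    exact lt_of_le_of_ne (hmin z hz.2) (Ne.symm hz.1)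
  rw [← hsup] at hyx'
  rw [hw]
  rw [hAS] at hA
  clear hAS hw hmax
  generalize insert y A = S at *
  have hm := sup_id_mem ⟨y, hyS⟩
  have hsubS' : ∀ B ∈ insert (S.erase (S.sup id)) s, B ⊆ S := by
    rw [forall_mem_insert]
    exact ⟨erase_subset _ _, hsubS⟩
  refine ⟨⟨mem_faces_of_subset (insert_nonempty _ _) hS ?_ hsubS', fun τ hτ h => ?_⟩, ?_⟩
  · rw [forall_mem_insert]
    refine ⟨⟨(erase_subset _ _).trans hSM, ?_⟩, hJ.2.1⟩
    rw [card_erase_of_mem hm, hS, Nat.add_sub_cancel]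
  · exact hs.1.2 τ hτ (subset_of_lowTriangle_subset_insert hτ hS hsubS h)
  · rintro _ ⟨S', -, hS', z, hz, q, hq, p, hp, hzq, hqp, hpm, rfl⟩ h
    rw [triple_subset] at h
    obtain rfl : S' = S := eq_of_subset_of_card_le
      (subset_of_erase_subset hqp.ne (hsubS' _ h.1) (hsubS' _ h.2.1)) (by rw [hS, hS'])
    have hyq := (hzS z hz).trans hzq
    have key : ∀ p ∈ S', p < S'.sup id → S'.erase p ∈ insert (S'.erase (S'.sup id)) s →
        S'.erase p ∈ s := fun p hp hpm h =>
      (mem_insert.1 h).resolve_left fun h => hpm.ne ((erase_inj S' hp).1 h)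
    exact hs.1.2 _ ⟨S', hSM, hS, y, hyS, q, hq, p, hp, hyq.ne, (hyq.trans hqp).ne, hqp.ne, hyx',
      hqp.trans hpm, hpm, rfl⟩
      (triple_subset.2 ⟨hA, key q hq (hqp.trans hpm) h.1, key p hp hpm h.2.1⟩)

/-- The edge case: the link of `{A, A - x + y}`, among lower faces, is a cone. -/
lemma insert_mem_of_edge {s : Finset (Finset ℕ)} {A : Finset ℕ}
    (hs : s ∈ (((cx M N).avoid (lowTriangles M N)).avoid (critTriangles M N)).faces)
    (hA : A ∈ s) {x y y₀ : ℕ} (hx : x ∈ A) (hy : y ∉ A) (hyx : y < x) (hy₀ : y₀ ∉ A)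
    (hy₀y : y₀ < y) (hB : insert y (A.erase x) ∈ s)
    (hmax : ∀ τ ∈ lowering M, 2 * ∑ i ∈ A, i + 2 < rank τ → ¬ τ ⊆ s) :
    insert (insert y₀ (A.erase x)) s ∈
      (((cx M N).avoid (lowTriangles M N)).avoid (critTriangles M N)).faces := by
  have hJ := hs.1.1
  obtain ⟨hAM, hAN⟩ := hJ.2.1 A hA
  have hyM : y ∈ range M := mem_range.2 (hyx.trans (mem_range.1 (hAM hx)))
  have hy₀M : y₀ ∈ range M := mem_range.2 (hy₀y.trans (mem_range.1 hyM))
  have hC : #(A.erase x) + 1 = N := by rw [card_erase_add_one hx, hAN]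
  have hsub : ∀ B ∈ s, A.erase x ⊆ B := by
    intro D hD
    obtain rfl | ⟨a, ha, b, hb, hba, rfl⟩ := eq_or_lower hJ hA hmax D hD
    · exact erase_subset _ _
    by_cases hax : a = x
    · exact hax ▸ subset_insert _ _
    exfalso
    obtain rfl : b = y := by
      by_contra hby
      have h1 := card_le_one.1 (hJ.2.2 _ hD _ hB) x (by
        have : x ≠ y := hyx.ne'
        simp [hx, this, Ne.symm hax]) b (by
        have : b ∉ A.erase x := fun h => hb (mem_of_mem_erase h)
        simp [this, hby])
      exact hb (h1 ▸ hx)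
    set S := insert b A with hSdef
    have hAS : A = S.erase b := (erase_insert hb).symm
    have hxS : insert b (A.erase x) = S.erase x := by
      rw [hSdef, erase_insert_of_ne hyx.ne]
    have haS : insert b (A.erase a) = S.erase a := by
      rw [hSdef, erase_insert_of_ne hba.ne]
    have hS : #S = N + 1 := by rw [card_insert_of_notMem hb, hAN]
    have hSM : S ⊆ range M := insert_subset hyM hAM
    have hy₀S : y₀ ∉ S := by
      rw [mem_insert, not_or]
      exact ⟨hy₀y.ne, hy₀⟩
    have hbS : b ∈ S := mem_insert_self _ _
    replace hx : x ∈ S := mem_insert_of_mem hx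
    replace ha : a ∈ S := mem_insert_of_mem ha
    rw [hAS] at hA
    rw [hxS] at hB
    rw [haS] at hD
    rcases (le_sup_id hx).lt_or_eq with hxm | hxm
    · rcases (le_sup_id ha).lt_or_eq with ham | ham
      · exact hs.1.2 _ ⟨S, hSM, hS, b, hbS, x, hx, a, ha, hyx.ne, hba.ne, Ne.symm hax,
          hyx.trans hxm, hxm, ham, rfl⟩ (triple_subset.2 ⟨hA, hB, hD⟩)
      · rw [ham] at hD
        exact hs.2 _ ⟨S, hSM, hS, y₀, hy₀S, b, hbS, x, hx, hy₀y, hyx, hxm, rfl⟩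
          (triple_subset.2 ⟨hA, hB, hD⟩)
    · have ham := lt_of_le_of_ne (le_sup_id ha) (hxm ▸ hax)
      rw [hxm] at hB
      exact hs.2 _ ⟨S, hSM, hS, y₀, hy₀S, b, hbS, a, ha, hy₀y, hba, ham, rfl⟩
        (triple_subset.2 ⟨hA, hD, hB⟩)
  refine mem_avoid_of_superset (insert_nonempty _ _) hC ?_ ?_ (C := A.erase x)
  · rw [forall_mem_insert]
    refine ⟨⟨insert_subset hy₀M ((erase_subset _ _).trans hAM), ?_⟩, hJ.2.1⟩
    rw [card_insert_of_notMem fun h => hy₀ (mem_of_mem_erase h), hC]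
  · rw [forall_mem_insert]
    exact ⟨subset_insert _ _, hsub⟩

theorem hEquiv_avoid_lowering :
    (((cx M N).avoid (lowTriangles M N)).avoid (critTriangles M N)).HEquiv
      ((((cx M N).avoid (lowTriangles M N)).avoid (critTriangles M N)).avoid (lowering M)) := by
  rw [← finite_lowering.coe_toFinset]
  refine AbsSC.collapse_finset _ _ rank fun τ hτ => ?_
  simp only [Set.Finite.mem_toFinset] at hτ ⊢
  obtain ⟨A, hAM, x, hx, y, hy, hyx, rfl | ⟨⟨z, hz, hzy⟩, rfl⟩⟩ := hτ <;>
    obtain ⟨y₀, hy₀, hmin⟩ := exists_least_notMem A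
  · have hy₀x := (hmin y hy).trans_lt hyx
    have hm := sup_id_mem ⟨x, hx⟩
    have hy₀m := hy₀x.trans_le (le_sup_id hx)
    refine ⟨singleton_nonempty _, insert y₀ (A.erase (A.sup id)), ?_, fun s hs hτs hmax => ?_⟩
    · rw [mem_singleton]
      intro h
      exact hy₀ (h ▸ mem_insert_self _ _)
    · simp only [rank_singleton] at hmax ⊢
      rw [singleton_subset_iff] at hτs
      exact ⟨insert_mem_of_vertex hs hτs hx hy₀ hy₀x hmin hmax, fun τ' hτ' hr h =>
        subset_of_lowering_subset_insert
          (eq_or_lower hs.1.1 hτs fun τ hτ h => hmax τ hτ (by lia)) hm hy₀ hy₀m hmin hτ' hr h⟩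
  · have hy₀y := (hmin z hz).trans_lt hzy
    refine ⟨insert_nonempty _ _, insert y₀ (A.erase x), ?_, fun s hs hτs hmax => ?_⟩
    · rw [mem_insert, mem_singleton, not_or]
      refine ⟨fun h => hy₀ (h ▸ mem_insert_self _ _), fun h => ?_⟩
      have : y₀ ∈ insert y (A.erase x) := h ▸ mem_insert_self _ _
      rw [mem_insert] at this
      exact this.elim hy₀y.ne fun h => hy₀ (mem_of_mem_erase h)
    · simp only [rank_pair hx hy hyx] at hmax ⊢
      rw [insert_subset_iff, singleton_subset_iff] at hτs
      exact ⟨insert_mem_of_edge hs hτs.1 hx hy hyx hy₀ hy₀y hτs.2 hmax, fun τ' hτ' hr h =>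
        subset_of_lowering_subset_insert (eq_or_lower hs.1.1 hτs.1 hmax) hx hy₀ (hy₀y.trans hyx)
          hmin hτ' (by lia) h⟩

lemma eq_range_of_not_lower {A : Finset ℕ} (h : ∀ x ∈ A, ∀ y ∉ A, x ≤ y) : A = range #A := by
  obtain ⟨y, hy, hmin⟩ := exists_least_notMem A
  have : A = range y := by
    ext a
    rw [mem_range]
    refine ⟨fun ha => lt_of_le_of_ne (h a ha y hy) fun e => hy (e ▸ ha), fun ha => ?_⟩
    by_contra haA
    exact absurd (hmin a haA) (by lia)
  rw [this, card_range]

lemma faces_avoid_lowering (h : N ≤ M) :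
    ((((cx M N).avoid (lowTriangles M N)).avoid (critTriangles M N)).avoid (lowering M)).faces =
      {{range N}} := by
  ext s
  rw [Set.mem_singleton_iff]
  constructor
  · intro hs
    refine (eq_singleton_iff_nonempty_unique_mem).2 ⟨hs.1.1.1.1, fun A hA => ?_⟩
    obtain ⟨hAM, rfl⟩ := hs.1.1.1.2.1 A hA
    refine eq_range_of_not_lower fun x hx y hy => ?_
    by_contra hxy
    exact hs.2 {A} ⟨A, hAM, x, hx, y, hy, not_le.1 hxy, Or.inl rfl⟩ (singleton_subset_iff.2 hA)
  · rintro rfl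
    refine ⟨⟨⟨⟨singleton_nonempty _, ?_, ?_⟩, ?_⟩, ?_⟩, ?_⟩
    · simpa using h
    · simp
    · rintro _ ⟨S, -, -, x, hx, y, -, z, -, hxy, -, -, -, -, -, rfl⟩ hsub
      simp only [triple_subset, mem_singleton] at hsub
      exact hxy ((erase_inj S hx).1 (hsub.1.trans hsub.2.1.symm))
    · rintro _ ⟨S, -, -, z, -, y, hy, x, hx, -, hyx, -, rfl⟩ hsub
      simp only [triple_subset, mem_singleton] at hsub
      exact hyx.ne ((erase_inj S hy).1 (hsub.1.trans hsub.2.1.symm))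
    · rintro _ ⟨A, -, x, hx, y, hy, hyx, hτ⟩ hsub
      have hA : A = range N := by
        rcases hτ with rfl | ⟨-, rfl⟩
        · exact mem_singleton.1 (singleton_subset_iff.1 hsub)
        · exact mem_singleton.1 (hsub (mem_insert_self _ _))
      rw [hA, mem_range] at hx hy
      lia

theorem contractibleSpace_of_faces_eq_singleton {V : Type} {K : AbsSC V} {v : V}
    (h : K.faces = {{v}}) : ContractibleSpace K.space := by
  classical
  have : Unique K.space := {
    default := ⟨Pi.single v 1, fun w => by
      by_cases hw : w = v
      · subst hw
        simp
      · simp [hw], {v}, by simp [h], fun w hw => by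
      by_contra hwv
      rw [mem_singleton] at hwv
      simp [hwv] at hw, by simp⟩
    uniq := fun f => by
      obtain ⟨f, h0, s, hs, hsupp, hsum⟩ := f
      rw [h, Set.mem_singleton_iff] at hs
      subst hs
      refine Subtype.ext (funext fun w => ?_)
      change f w = Pi.single (M := fun _ => ℝ) v 1 w
      by_cases hw : w = v
      · subst hw
        simpa using hsum
      · rw [Pi.single_eq_of_ne hw]
        exact not_not.1 (mt (hsupp w) (by simpa using hw)) }
  infer_instance

theorem contractibleSpace_avoid (h : N ≤ M) : ContractibleSpace
    (((cx M N).avoid (lowTriangles M N)).avoid (critTriangles M N)).space := by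
  have := contractibleSpace_of_faces_eq_singleton (faces_avoid_lowering h)
  obtain ⟨e⟩ := hEquiv_avoid_lowering (M := M) (N := N)
  exact e.contractibleSpace

theorem hEquivTop_wedgeSph (h : N ≤ M) :
    (cx M N).HEquivTop (WedgeSph 2 (finite_critTriangles (M := M) (N := N)).toFinset.card) := by
  have := contractibleSpace_avoid h
  rw [← finite_critTriangles.coe_toFinset] at this
  obtain ⟨e⟩ := hEquiv_avoid_lowTriangles (M := M) (N := N)
  obtain ⟨e'⟩ := ((cx M N).avoid (lowTriangles M N)).hEquivTop_wedgeSph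
    (finite_faces.subset (AbsSC.avoid_faces_subset _ _)) finite_critTriangles.toFinset
    (fun t ht => critTriangles_subset_faces (finite_critTriangles.mem_toFinset.1 ht))
    (fun t ht => card_of_mem_critTriangles (finite_critTriangles.mem_toFinset.1 ht))
    (fun t ht s hs => eq_of_critTriangle_subset (finite_critTriangles.mem_toFinset.1 ht) hs)
  exact ⟨e.trans e'⟩

end Johnson

namespace Johnson

variable {M N : ℕ}

/-- Data determining a critical triangle: `k = N - z` with `z` the least missing element of `S`, the
part of `S` above `z`, and the pair `{y, x}`. -/
def critData (M N : ℕ) : Finset ((_ : ℕ) × (_ : Finset ℕ) × Finset ℕ) :=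
  (Icc 2 N).sigma fun k => (powersetCard (k + 1) (Ioo (N - k) M)).sigma fun S =>
    powersetCard 2 (S.erase (S.sup id))

lemma card_critData :
    #(critData M N) = ∑ k ∈ Icc 2 N, (M + k - 1 - N).choose (k + 1) * k.choose 2 := by
  rw [critData, card_sigma]
  refine sum_congr rfl fun k hk => ?_
  rw [mem_Icc] at hk
  have : ∀ S ∈ powersetCard (k + 1) (Ioo (N - k) M),
      #(powersetCard 2 (S.erase (S.sup id))) = k.choose 2 := fun S hS => by
    obtain ⟨-, hS⟩ := mem_powersetCard.1 hS
    rw [card_powersetCard, card_erase_of_mem (sup_id_mem (card_pos.1 (by lia))), hS,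
      Nat.add_sub_cancel]
  rw [card_sigma, sum_congr rfl this, sum_const, card_powersetCard, Nat.card_Ioo, smul_eq_mul]
  congr 2
  lia

/-- The critical triangle with given data. -/
def critOf (N : ℕ) (d : (_ : ℕ) × (_ : Finset ℕ) × Finset ℕ) : Finset (Finset ℕ) :=
  (insert (d.2.1.sup id) d.2.2).image (range (N - d.1) ∪ d.2.1).erase

lemma mem_critData {k : ℕ} {S P : Finset ℕ} : (⟨k, S, P⟩ : (_ : ℕ) × (_ : Finset ℕ) × Finset ℕ) ∈
    critData M N ↔ (2 ≤ k ∧ k ≤ N) ∧ (S ⊆ Ioo (N - k) M ∧ #S = k + 1) ∧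
      P ⊆ S.erase (S.sup id) ∧ #P = 2 := by
  simp only [critData, mem_sigma, mem_Icc, mem_powersetCard]

lemma sup_id_range_union {z : ℕ} {S : Finset ℕ} (hS : S.Nonempty) (h : ∀ x ∈ S, z < x) :
    (range z ∪ S).sup id = S.sup id := by
  rw [sup_union, sup_eq_right]
  refine Finset.sup_le fun x hx => ?_
  exact ((mem_range.1 hx).trans (h _ (sup_id_mem hS))).le

lemma critOf_mem {d} (hd : d ∈ critData M N) : critOf N d ∈ critTriangles M N := by
  obtain ⟨k, S, P⟩ := d
  obtain ⟨hk, ⟨hSM, hS⟩, hPS, hP⟩ := mem_critData.1 hd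
  have hSI : ∀ x ∈ S, N - k < x ∧ x < M := fun x hx => mem_Ioo.1 (hSM hx)
  have hne : S.Nonempty := card_pos.1 (by lia)
  have hsup := sup_id_range_union hne fun x hx => (hSI x hx).1
  have hm := hSI _ (sup_id_mem hne)
  have key : ∀ y ∈ P, ∀ x ∈ P, y < x → P = {y, x} → critOf N ⟨k, S, P⟩ ∈ critTriangles M N := by
    rintro y hy x hx hyx rfl
    obtain ⟨-, hyS⟩ := mem_erase.1 (hPS hy)
    obtain ⟨hxm, hxS⟩ := mem_erase.1 (hPS hx)
    refine ⟨range (N - k) ∪ S, ?_, ?_, N - k, ?_, y, mem_union_right _ hyS, x,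
      mem_union_right _ hxS, (hSI y hyS).1, hyx, ?_, ?_⟩
    · refine union_subset (range_subset_range.2 (by lia)) fun c hc => mem_range.2 (hSI c hc).2
    · rw [card_union_of_disjoint, card_range, hS]
      · lia
      · rw [disjoint_left]
        intro c hc hcS
        exact absurd (mem_range.1 hc) (hSI c hcS).1.le.not_gt
    · simp only [mem_union, mem_range, lt_self_iff_false, false_or]
      exact fun h => (hSI _ h).1.false
    · rw [hsup]
      exact lt_of_le_of_ne (le_sup_id hxS) hxm
    · simp only [critOf, image_insert, image_singleton, hsup]
      ext
      simp only [mem_insert, mem_singleton]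
      tauto
  obtain ⟨y, x, hyx, hPyx⟩ := card_eq_two.1 hP
  rcases hyx.lt_or_gt with h | h
  · exact key y (by simp [hPyx]) x (by simp [hPyx]) h hPyx
  · exact key x (by simp [hPyx]) y (by simp [hPyx]) h (hPyx.trans (pair_comm _ _))

lemma critOf_injOn : Set.InjOn (critOf N) (critData M N) := by
  have hsub : ∀ d ∈ critData M N, ∀ d' ∈ critData M N, critOf N d = critOf N d' →
      range (N - d.1) ∪ d.2.1 ⊆ range (N - d'.1) ∪ d'.2.1 := by
    rintro ⟨k, S, P⟩ hd ⟨k', S', P'⟩ - h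
    obtain ⟨-, -, hPS, hP⟩ := mem_critData.1 hd
    obtain ⟨y, x, hyx, rfl⟩ := card_eq_two.1 hP
    have key : ∀ p ∈ ({y, x} : Finset ℕ), (range (N - k) ∪ S).erase p ⊆ range (N - k') ∪ S' := by
      intro p hp
      have : (range (N - k) ∪ S).erase p ∈ critOf N ⟨k', S', P'⟩ :=
        h ▸ mem_image_of_mem _ (mem_insert_of_mem hp)
      obtain ⟨q, -, hq⟩ := mem_image.1 this
      exact hq ▸ erase_subset _ _
    exact subset_of_erase_subset hyx (key y (by simp)) (key x (by simp))
  rintro ⟨k, S, P⟩ hd ⟨k', S', P'⟩ hd' h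
  have hU : range (N - k) ∪ S = range (N - k') ∪ S' :=
    Subset.antisymm (hsub _ hd _ hd' h) (hsub _ hd' _ hd h.symm)
  obtain ⟨hk, ⟨hSM, hS⟩, hPS, hP⟩ := mem_critData.1 hd
  obtain ⟨hk', ⟨hSM', hS'⟩, hPS', hP'⟩ := mem_critData.1 hd'
  have hmem : ∀ c, (c < N - k ∨ c ∈ S) ↔ (c < N - k' ∨ c ∈ S') := fun c => by
    rw [← mem_range, ← mem_union, hU, mem_union, mem_range]
  have hSI : ∀ c ∈ S, N - k < c := fun c hc => (mem_Ioo.1 (hSM hc)).1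
  have hSI' : ∀ c ∈ S', N - k' < c := fun c hc => (mem_Ioo.1 (hSM' hc)).1
  have hkk : N - k = N - k' := by
    refine le_antisymm ?_ ?_
    · by_contra hlt
      have h1 := (hmem (N - k')).1 (Or.inl (by lia))
      exact h1.elim (lt_irrefl _) fun h => lt_irrefl _ (hSI' _ h)
    · by_contra hlt
      have h1 := (hmem (N - k)).2 (Or.inl (by lia))
      exact h1.elim (lt_irrefl _) fun h => lt_irrefl _ (hSI _ h)
  obtain rfl : k = k' := by lia
  obtain rfl : S = S' := by
    ext c
    refine ⟨fun hc => ?_, fun hc => ?_⟩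
    · exact ((hmem c).1 (Or.inr hc)).resolve_left (hSI c hc).not_gt
    · exact ((hmem c).2 (Or.inr hc)).resolve_left (hSI' c hc).not_gt
  have hmS := sup_id_mem (S := S) (card_pos.1 (by lia))
  have hins : insert (S.sup id) P = insert (S.sup id) P' := by
    have hsub' : ∀ {Q}, Q ⊆ S.erase (S.sup id) → insert (S.sup id) Q ⊆ range (N - k) ∪ S :=
      fun hQ => (insert_subset hmS (hQ.trans (erase_subset _ _))).trans subset_union_right
    refine coe_injective ((erase_injOn (range (N - k) ∪ S)).image_eq_image_iff (hsub' hPS) (hsub' hPS') |>.1 ?_)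
    simpa only [critOf, coe_image] using congrArg ((↑) : _ → Set (Finset ℕ)) h
  have hPP : P = P' := by
    rw [← erase_insert fun h => notMem_erase _ _ (hPS h), hins,
      erase_insert fun h => notMem_erase _ _ (hPS' h)]
  rw [hPP]

lemma critOf_surjOn : Set.SurjOn (critOf N) (critData M N) (critTriangles M N) := by
  rintro _ ⟨S, hSM, hS, z, hz, y, hy, x, hx, hzy, hyx, hxm, rfl⟩
  obtain ⟨w, hw, hmin⟩ := exists_least_notMem S
  have hwz := hmin z hz
  have hm := sup_id_mem ⟨x, hx⟩
  have hSw : range w ∪ {c ∈ S | w < c} = S := by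
    ext c
    rw [mem_union, mem_range, mem_filter]
    constructor
    · rintro (h | h)
      · by_contra hc
        exact absurd (hmin c hc) (by lia)
      · exact h.1
    · intro hc
      have : c ≠ w := fun h => hw (h ▸ hc)
      rcases this.lt_or_gt with h | h
      exacts [Or.inl h, Or.inr ⟨hc, h⟩]
  have hmem : ∀ {c}, c ∈ S → y ≤ c → c ∈ {c ∈ S | w < c} := fun hc hyc =>
    mem_filter.2 ⟨hc, by lia⟩
  have hsup : ({c ∈ S | w < c}).sup id = S.sup id :=
    le_antisymm (sup_mono (filter_subset _ _)) (le_sup_id (hmem hm (by lia)))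
  have hcard : w + #({c ∈ S | w < c}) = N + 1 := by
    rw [← hS]
    conv_rhs => rw [← hSw]
    rw [card_union_of_disjoint, card_range]
    rw [disjoint_left]
    intro c hc hcS
    exact absurd (mem_range.1 hc) (mem_filter.1 hcS).2.le.not_gt
  have h3 : 3 ≤ #({c ∈ S | w < c}) := by
    have : ({y, x, S.sup id} : Finset ℕ) ⊆ {c ∈ S | w < c} := by
      exact insert_subset (hmem hy le_rfl) (insert_subset (hmem hx hyx.le)
        (singleton_subset_iff.2 (hmem hm (by lia))))
    refine le_of_eq_of_le ?_ (card_le_card this)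
    exact (card_eq_three.2 ⟨_, _, _, hyx.ne, (hyx.trans hxm).ne, hxm.ne, rfl⟩).symm
  have hk : N - (N - w) = w := by lia
  refine ⟨⟨N - w, {c ∈ S | w < c}, {y, x}⟩, mem_coe.2 (mem_critData.2 ⟨by lia, ⟨?_, by lia⟩,
    ?_, card_pair hyx.ne⟩), ?_⟩
  · intro c hc
    rw [mem_filter] at hc
    rw [mem_Ioo, hk]
    exact ⟨hc.2, mem_range.1 (hSM hc.1)⟩
  · rw [hsup]
    exact insert_subset (mem_erase.2 ⟨(hyx.trans hxm).ne, hmem hy le_rfl⟩)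
      (singleton_subset_iff.2 (mem_erase.2 ⟨hxm.ne, hmem hx hyx.le⟩))
  · simp only [critOf, hk, hsup, hSw, image_insert, image_singleton]
    ext
    simp only [mem_insert, mem_singleton]
    tauto

theorem card_critTriangles : #(finite_critTriangles (M := M) (N := N)).toFinset =
    ∑ k ∈ Icc 2 N, (M + k - 1 - N).choose (k + 1) * k.choose 2 := by
  rw [← card_critData]
  refine (card_nbij (critOf N) (fun d hd => ?_) critOf_injOn ?_).symm
  · exact finite_critTriangles.mem_toFinset.2 (critOf_mem hd)
  · rw [Set.Finite.coe_toFinset]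
    exact critOf_surjOn

end Johnson

namespace AbsSC

/-- A relabelling of the vertices induces a homeomorphism of realizations. -/
def homeomorphOfEquiv {V W : Type} {K : AbsSC V} {L : AbsSC W} (e : V ≃ W)
    (h : ∀ s, s ∈ K.faces ↔ s.map e.toEmbedding ∈ L.faces) : K.space ≃ₜ L.space where
  toFun f := ⟨f.1 ∘ e.symm, fun w => f.2.1 _, by
    obtain ⟨s, hs, hsupp, hsum⟩ := f.2.2
    refine ⟨_, (h s).1 hs, fun w hw => mem_map_equiv.2 (hsupp _ hw), ?_⟩
    simpa using hsum⟩
  invFun f := ⟨f.1 ∘ e, fun w => f.2.1 _, by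
    obtain ⟨s, hs, hsupp, hsum⟩ := f.2.2
    have hs' : (s.map e.symm.toEmbedding).map e.toEmbedding = s := by
      simp [map_map]
    refine ⟨s.map e.symm.toEmbedding, (h _).2 (hs'.symm ▸ hs), fun v hv => ?_, ?_⟩
    · exact mem_map_equiv.2 (hsupp _ hv)
    · simpa using hsum⟩
  left_inv f := Subtype.ext (funext fun v => congrArg f.1 (e.symm_apply_apply v))
  right_inv f := Subtype.ext (funext fun v => congrArg f.1 (e.apply_symm_apply v))
  continuous_toFun := by
    refine Continuous.subtype_mk (continuous_pi fun w => ?_) _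
    exact (continuous_apply (e.symm w)).comp continuous_subtype_val
  continuous_invFun := by
    refine Continuous.subtype_mk (continuous_pi fun v => ?_) _
    exact (continuous_apply (e v)).comp continuous_subtype_val

end AbsSC

namespace Johnson

/-- The involution exchanging the `n`-sets avoiding `0` with the `(n + 1)`-sets containing `0`. -/
def toggleZero (n : ℕ) (A : Finset ℕ) : Finset ℕ :=
  if 0 ∈ A then if #A = n + 1 then A.erase 0 else A else if #A = n then insert 0 A else A

lemma toggleZero_involutive (n : ℕ) : Function.Involutive (toggleZero n) := by
  intro A
  by_cases h0 : 0 ∈ A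
  · by_cases hc : #A = n + 1
    · have : #(A.erase 0) = n := by rw [card_erase_of_mem h0, hc, Nat.add_sub_cancel]
      simp [toggleZero, h0, hc, this]
    · simp [toggleZero, h0, hc]
  · by_cases hc : #A = n
    · have : #(insert 0 A) = n + 1 := by rw [card_insert_of_notMem h0, hc]
      simp [toggleZero, h0, hc, this]
    · simp [toggleZero, h0, hc]

lemma subset_Icc_one_iff {m : ℕ} {A : Finset ℕ} : A ⊆ Icc 1 m ↔ A ⊆ range (m + 1) ∧ 0 ∉ A := by
  constructor
  · intro h
    exact ⟨fun c hc => mem_range.2 (Nat.lt_succ_iff.2 (mem_Icc.1 (h hc)).2),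
      fun h0 => absurd (mem_Icc.1 (h h0)).1 (by lia)⟩
  · rintro ⟨h, h0⟩ c hc
    have : c ≠ 0 := fun e => h0 (e ▸ hc)
    have := mem_range.1 (h hc)
    exact mem_Icc.2 ⟨by lia, by lia⟩

lemma toggleZero_mem_iff {m n : ℕ} {A : Finset ℕ} :
    (toggleZero n A ⊆ range (m + 1) ∧ #(toggleZero n A) = n + 1) ↔
      A ∈ Fnm m n ∪ Fnm m (n + 1) := by
  simp only [Fnm, Set.mem_union, Set.mem_ofPred_eq, subset_Icc_one_iff]
  by_cases h0 : 0 ∈ A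
  · by_cases hc : #A = n + 1
    · have : #(A.erase 0) = n := by rw [card_erase_of_mem h0, hc, Nat.add_sub_cancel]
      simp [toggleZero, h0, hc, this]
    · simp [toggleZero, h0, hc]
  · by_cases hc : #A = n
    · simp [toggleZero, h0, hc, card_insert_of_notMem h0, insert_subset_iff]
    · simp [toggleZero, h0, hc]

lemma card_toggleZero_sdiff_le_iff {m n : ℕ} {A B : Finset ℕ} (hA : A ∈ Fnm m n ∪ Fnm m (n + 1))
    (hB : B ∈ Fnm m n ∪ Fnm m (n + 1)) :
    #(toggleZero n A \ toggleZero n B) ≤ 1 ↔ #(symmDiff A B) ≤ 2 := by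
  have hsymm : #(symmDiff A B) = #(A \ B) + #(B \ A) := card_union_of_disjoint disjoint_sdiff_sdiff
  have hcomm : #(A \ B) + #B = #(B \ A) + #A := by
    rw [card_sdiff_add_card, card_sdiff_add_card, union_comm]
  simp only [Fnm, Set.mem_union, Set.mem_ofPred_eq, subset_Icc_one_iff] at hA hB
  have hA0 : 0 ∉ A := hA.elim (fun h => h.1.2) fun h => h.1.2
  have hB0 : 0 ∉ B := hB.elim (fun h => h.1.2) fun h => h.1.2
  rcases hA with ⟨-, hA⟩ | ⟨-, hA⟩ <;> rcases hB with ⟨-, hB⟩ | ⟨-, hB⟩ <;>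
    simp [toggleZero, hA0, hB0, hA, hB, insert_sdiff_of_notMem, sdiff_insert_of_notMem,
      -card_eq_zero] <;> lia

lemma hEquiv_vrc (m n : ℕ) : (VRc (Fnm m n ∪ Fnm m (n + 1)) 2).HEquiv (cx (m + 1) (n + 1)) := by
  refine ⟨(AbsSC.homeomorphOfEquiv (toggleZero_involutive n).toPerm fun s => ?_).toHomotopyEquiv⟩
  simp only [VRc, cx, Set.mem_ofPred_eq, map_nonempty, forall_mem_map, Equiv.toEmbedding_apply,
    Function.Involutive.coe_toPerm, toggleZero_mem_iff]
  refine and_congr_right fun _ => and_congr_right fun h => ?_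
  exact forall₄_congr fun A hA B hB => (card_toggleZero_sdiff_le_iff (h A hA) (h B hB)).symm

end Johnson

/-- For `1 < n < m - 1`, `VR(F_n^m ∪ F_{n+1}^m, 2)` is homotopy equivalent
to a wedge of `Σ_{k=2}^{n} C(m+k-1-n, k+1)·C(k,2) + C(m, n+2)·C(n+1, 2)` copies of `S²`. -/
theorem stmt11 (m n : ℕ) (h1 : 1 < n) (h2 : n + 1 < m) :
    AbsSC.HEquivTop (VRc (Fnm m n ∪ Fnm m (n + 1)) 2)
      (WedgeSph 2 ((∑ k ∈ Finset.Icc 2 n, Nat.choose (m + k - 1 - n) (k + 1) * k.choose 2) +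
        m.choose (n + 2) * (n + 1).choose 2)) := by
  obtain ⟨e⟩ := Johnson.hEquiv_vrc m n
  obtain ⟨e'⟩ := Johnson.hEquivTop_wedgeSph (M := m + 1) (N := n + 1) (by lia)
  have hcard : #(Johnson.finite_critTriangles (M := m + 1) (N := n + 1)).toFinset =
      (∑ k ∈ Finset.Icc 2 n, Nat.choose (m + k - 1 - n) (k + 1) * k.choose 2) +
        m.choose (n + 2) * (n + 1).choose 2 := by
    rw [Johnson.card_critTriangles, sum_Icc_succ_top (show 2 ≤ n + 1 by lia),
      show m + 1 + (n + 1) - 1 - (n + 1) = m by lia]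
    simp only [show ∀ k, m + 1 + k - 1 - (n + 1) = m + k - 1 - n by lia]
  rw [hcard] at e'
  exact ⟨e.trans e'⟩
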